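/- arXiv:1407.2321 — 4 statements merged into one kernel-verified Lean document; each statement's English description precedes it below -/
import Mathlib

section
/- If Λ is a left noetherian ring, then the left big finitistic dimension of Λ is bounded above by the injective dimension of Λ as a left module over itself: l Fin dim Λ ≤ idim(ΛΛ). -/
open CategoryTheory

universe u

section Preamble

variable (R : Type u) [Ring R]

/-- `PdimLE R n M` : the left `R`-module `M` has projective dimension at most `n`,
i.e. it admits a projective resolution of length at most `n`. -/
def PdimLE : ℕ → ModuleCat.{u} R → Prop
  | 0, M => Module.Projective R M
  | n + 1, M =>
    ∃ (P : ModuleCat.{u} R) (f : ↥P →ₗ[R] ↥M),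
      Module.Projective R ↥P ∧ Function.Surjective f ∧
        PdimLE n (ModuleCat.of R (LinearMap.ker f))

/-- `M` has projective dimension exactly `d`. -/
def PdimEq (M : ModuleCat.{u} R) (d : ℕ) : Prop :=
  PdimLE R d M ∧ ∀ k, PdimLE R k M → d ≤ k

/-- The projective dimension of `M`, as an element of `ℕ∞` (`⊤` = infinite). -/
noncomputable def pdim (M : ModuleCat.{u} R) : ℕ∞ :=
  sInf {d : ℕ∞ | ∃ n : ℕ, d = n ∧ PdimLE R n M}

/-- `IdimLE R n M` : the left `R`-module `M` has injective dimension at most `n`. -/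
def IdimLE : ℕ → ModuleCat.{u} R → Prop
  | 0, M => Module.Injective R M
  | n + 1, M =>
    ∃ (E : ModuleCat.{u} R) (f : ↥M →ₗ[R] ↥E),
      Module.Injective R ↥E ∧ Function.Injective f ∧
        IdimLE n (ModuleCat.of R (↥E ⧸ LinearMap.range f))

/-- The injective dimension of `M`, as an element of `ℕ∞`. -/
noncomputable def idim (M : ModuleCat.{u} R) : ℕ∞ :=
  sInf {d : ℕ∞ | ∃ n : ℕ, d = n ∧ IdimLE R n M}

/-- The (left) big finitistic dimension of `R`: the supremum of the projective
dimensions of all (left) `R`-modules of finite projective dimension. -/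
noncomputable def bigFinDim : ℕ∞ :=
  sSup {d : ℕ∞ | d ≠ ⊤ ∧ ∃ M : ModuleCat.{u} R, pdim R M = d}

/-- The (left) little finitistic dimension of `R`: the supremum of the projective
dimensions of all finitely generated (left) `R`-modules of finite projective dimension. -/
noncomputable def littleFinDim : ℕ∞ :=
  sSup {d : ℕ∞ | d ≠ ⊤ ∧ ∃ M : ModuleCat.{u} R, Module.Finite R ↥M ∧ pdim R M = d}

/-- The (left) global dimension of `R`, as an element of `ℕ∞`. -/
noncomputable def glDim : ℕ∞ :=
  sInf {d : ℕ∞ | ∃ n : ℕ, d = n ∧ ∀ M : ModuleCat.{u} R, PdimLE R n M}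

/-- `A` is (isomorphic to) a direct summand of `B`. -/
def IsSummand (A B : ModuleCat.{u} R) : Prop :=
  ∃ C : ModuleCat.{u} R, Nonempty ((↥A × ↥C) ≃ₗ[R] ↥B)

/-- A minimal projective resolution of `M`, recorded through its syzygies:
`Ω 0 ≅ M`, and for each `n` the map `f n : P n → Ω n` is a projective cover
(i.e. `P n` is projective, `f n` is surjective and its kernel is superfluous in `P n`),
with `Ω (n+1) ≅ ker (f n)`. -/
structure SyzygyChain (M : ModuleCat.{u} R) : Type (u + 1) where
  Ω : ℕ → ModuleCat.{u} R
  P : ℕ → ModuleCat.{u} R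
  projective : ∀ n, Module.Projective R ↥(P n)
  f : ∀ n, ↥(P n) →ₗ[R] ↥(Ω n)
  surj : ∀ n, Function.Surjective (f n)
  minimal : ∀ n, ∀ N : Submodule R ↥(P n), N ⊔ LinearMap.ker (f n) = ⊤ → N = ⊤
  iso0 : Nonempty (↥(Ω 0) ≃ₗ[R] ↥M)
  isoSucc : ∀ n, Nonempty (↥(Ω (n + 1)) ≃ₗ[R] ↥(LinearMap.ker (f n)))

/-- The minimal projective resolution is repetitive at degree `k`: the `k`-th
syzygy decomposes as `P ⊕ ⨁ᵢ Aᵢ` with `P` projective and each `Aᵢ` a direct summand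
of infinitely many syzygies. -/
def RepAt {M : ModuleCat.{u} R} (c : SyzygyChain R M) (k : ℕ) : Prop :=
  ∃ (ι : Type u) (A : ι → ModuleCat.{u} R) (P : ModuleCat.{u} R),
    Module.Projective R ↥P ∧
    (∀ i, {j : ℕ | IsSummand R (A i) (c.Ω j)}.Infinite) ∧
    Nonempty (↥(c.Ω k) ≃ₗ[R] (↥P × DirectSum ι fun i => ↥(A i)))

/-- The repetition index of a module (with a given minimal projective resolution),
as an element of `ℕ∞`. -/
noncomputable def repIndex {M : ModuleCat.{u} R} (c : SyzygyChain R M) : ℕ∞ :=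
  sInf {d : ℕ∞ | ∃ k : ℕ, d = k ∧ RepAt R c k}

/-- The (left) global repetition index of `R`. -/
noncomputable def glRep : ℕ∞ :=
  sSup {d : ℕ∞ | ∃ (M : ModuleCat.{u} R) (c : SyzygyChain R M), repIndex R c = d}

/-- The syzygy category of `M` (given a minimal projective resolution `c` of `M`)
is a Krull-Schmidt category of finite representation type, with the `s` modules
`A 0, …, A (s-1)` as representatives of the isomorphism classes of its nonzero
indecomposable objects: the `A i` have local endomorphism rings, are pairwise
non-isomorphic, each occurs as a direct summand of some syzygy, and every syzygy
is a finite direct sum of copies of the `A i`. -/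
def HasSyzygyType {M : ModuleCat.{u} R} (c : SyzygyChain R M) (s : ℕ)
    (A : Fin s → ModuleCat.{u} R) : Prop :=
  (∀ i, IsLocalRing (Module.End R ↥(A i))) ∧
  (∀ i j : Fin s, i ≠ j → IsEmpty (↥(A i) ≃ₗ[R] ↥(A j))) ∧
  (∀ i, ∃ j, IsSummand R (A i) (c.Ω j)) ∧
  (∀ j, ∃ m : Fin s → ℕ, Nonempty (↥(c.Ω j) ≃ₗ[R] ((i : Fin s) → Fin (m i) → ↥(A i))))

/-- Truncating a minimal projective resolution of `M` gives a minimal projective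
resolution of the `m`-th syzygy of `M`. -/
def SyzygyChain.shift {M : ModuleCat.{u} R} (c : SyzygyChain R M) (m : ℕ) :
    SyzygyChain R (c.Ω m) where
  Ω := fun j => c.Ω (m + j)
  P := fun j => c.P (m + j)
  projective := fun j => c.projective (m + j)
  f := fun j => c.f (m + j)
  surj := fun j => c.surj (m + j)
  minimal := fun j => c.minimal (m + j)
  iso0 := ⟨LinearEquiv.refl R ↥(c.Ω (m + 0))⟩
  isoSucc := fun j => c.isoSucc (m + j)

/-- The radical (Jacobson radical) of `R` as a left module over itself:
the intersection of all maximal submodules. -/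
def ringRadical : Submodule R R := sInf {m : Submodule R R | IsCoatom m}

/-- `R / rad R` as a left `R`-module. -/
noncomputable abbrev radQuot : ModuleCat.{u} R := ModuleCat.of R (R ⧸ ringRadical R)

/-- `X` embeds into `T`. -/
def EmbedsIn (X T : ModuleCat.{u} R) : Prop := ∃ g : ↥X →ₗ[R] ↥T, Function.Injective g

/-- The homological contingency of `A` to `M` (with minimal projective resolution `c`)
equals the integer `z`: `z` is the greatest element of `{-1} ∪ {j | A is a direct
summand of Ω^j(M)}`.  (So `z = -1` iff `A` is a summand of no syzygy, and no such `z`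
exists iff the contingency is infinite.) -/
def ContEq {M : ModuleCat.{u} R} (c : SyzygyChain R M) (A : ModuleCat.{u} R) (z : ℤ) : Prop :=
  IsGreatest (insert (-1) ((fun j : ℕ => (j : ℤ)) '' {j | IsSummand R A (c.Ω j)})) z

/-- `E` is an injective envelope of `X`: `E` is injective and contains a copy of `X`
as an essential submodule. -/
def IsInjectiveEnvelopeOf (X E : ModuleCat.{u} R) : Prop :=
  ∃ f : ↥X →ₗ[R] ↥E, Module.Injective R ↥E ∧ Function.Injective f ∧
    ∀ N : Submodule R ↥E, N ≠ ⊥ → N ⊓ LinearMap.range f ≠ ⊥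

end Preamble

section HomologicalDimension

open Abelian

variable {R : Type u} [Ring R]

theorem shortExact_ker {M P : ModuleCat.{u} R} (f : ↥P →ₗ[R] ↥M) (hf : Function.Surjective f) :
    (ModuleCat.shortComplexOfCompEqZero (LinearMap.ker f).subtype f
      f.exact_subtype_ker_map.linearMap_comp_eq_zero).ShortExact :=
  ModuleCat.shortComplex_shortExact _ f.exact_subtype_ker_map
    (Submodule.subtype_injective _) hf

theorem PdimLE.hasProjectiveDimensionLE {n : ℕ} {M : ModuleCat.{u} R} (h : PdimLE R n M) :
    HasProjectiveDimensionLE M n := by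
  induction n generalizing M with
  | zero =>
    exact projective_iff_hasProjectiveDimensionLE_zero M |>.1
      ((IsProjective.iff_projective (R := R) M).1 h)
  | succ n ih =>
    obtain ⟨P, f, hP, hf, hK⟩ := h
    exact ((shortExact_ker f hf).hasProjectiveDimensionLT_X₃_iff n
      ((IsProjective.iff_projective (R := R) P).1 hP)).2 (ih hK)

theorem PdimLE.of_hasProjectiveDimensionLE {n : ℕ} {M : ModuleCat.{u} R}
    (h : HasProjectiveDimensionLE M n) : PdimLE R n M := by
  induction n generalizing M with
  | zero =>
    exact (IsProjective.iff_projective (R := R) M).2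
      ((projective_iff_hasProjectiveDimensionLE_zero M).2 h)
  | succ n ih =>
    have hf := Finsupp.linearCombination_id_surjective R M
    refine ⟨ModuleCat.of R (M →₀ R), Finsupp.linearCombination R id, inferInstance, hf, ih ?_⟩
    exact ((shortExact_ker (P := ModuleCat.of R (M →₀ R)) _ hf).hasProjectiveDimensionLT_X₃_iff n
      ((IsProjective.iff_projective (R := R) (M →₀ R)).1 inferInstance)).1 h

/-- Over a noetherian ring, direct sums of copies of an injective module are injective. -/
theorem Module.Injective.finsupp [IsNoetherianRing R] (ι : Type u) (E : Type u) [AddCommGroup E]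
    [Module R E] (hE : Module.Injective R E) : Module.Injective R (ι →₀ E) := by
  classical
  refine Module.Baer.injective fun I g ↦ ?_
  obtain ⟨t, ht⟩ := (IsNoetherian.noetherian (⊤ : Submodule R I))
  let s : Finset ι := t.biUnion fun x ↦ (g x).support
  have hs (x : I) : g x ∈ Finsupp.supported E R (s : Set ι) := by
    have : (⊤ : Submodule R I) ≤ (Finsupp.supported E R (s : Set ι)).comap g := by
      rw [← ht, Submodule.span_le]
      intro y hy
      exact Finset.coe_subset.2 (Finset.subset_biUnion_of_mem (fun x ↦ (g x).support) hy)
    exact this trivial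
  choose G hG using fun i ↦ Module.Baer.of_injective hE I (Finsupp.lapply i ∘ₗ g)
  refine ⟨∑ i ∈ s, Finsupp.lsingle i ∘ₗ G i, fun x hx ↦ ?_⟩
  have h := Finsupp.sum_of_support_subset (g ⟨x, hx⟩) (s := s)
    (Finset.coe_subset.1 (hs ⟨x, hx⟩)) Finsupp.single (by simp)
  rw [Finsupp.sum_single] at h
  rw [h]
  simp [LinearMap.sum_apply, hG _ x hx]

theorem IdimLE.hasInjectiveDimensionLE_finsupp [IsNoetherianRing R] (ι : Type u) {n : ℕ}
    {M : ModuleCat.{u} R} (h : IdimLE R n M) :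
    HasInjectiveDimensionLE (ModuleCat.of R (ι →₀ M)) n := by
  induction n generalizing M with
  | zero =>
    exact injective_iff_hasInjectiveDimensionLT_one.1
      ((Module.injective_iff_injective_object R (ι →₀ M)).1 (Module.Injective.finsupp ι M h))
  | succ n ih =>
    obtain ⟨E, f, hE, hf, hC⟩ := h
    have hex : Function.Exact (Finsupp.mapRange.linearMap (α := ι) f)
        (Finsupp.mapRange.linearMap (α := ι) (LinearMap.range f).mkQ) := by
      rw [LinearMap.exact_iff, Finsupp.ker_mapRange, Finsupp.range_mapRange_linearMap,
        Submodule.ker_mkQ]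
      exact LinearMap.ker_eq_bot.2 hf
    have hS := ModuleCat.shortComplex_shortExact
      (ModuleCat.shortComplexOfCompEqZero _ _ hex.linearMap_comp_eq_zero) hex
      (Finsupp.mapRange_injective f (map_zero f) hf)
      (Finsupp.mapRange_surjective _ (map_zero _) (Submodule.mkQ_surjective _))
    exact (hS.hasInjectiveDimensionLT_X₃_iff n
      ((Module.injective_iff_injective_object R (ι →₀ E)).1 (Module.Injective.finsupp ι E hE))).1
      (ih hC)

/-- If every free module has injective dimension at most `n`, then every module of finite
projective dimension has projective dimension at most `n`. -/
theorem hasProjectiveDimensionLE_of_free {n m : ℕ}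
    (hfree : ∀ ι : Type u, HasInjectiveDimensionLE (ModuleCat.of R (ι →₀ R)) n)
    {M : ModuleCat.{u} R} (hM : HasProjectiveDimensionLE M m) :
    HasProjectiveDimensionLE M n := by
  induction m with
  | zero => exact hasProjectiveDimensionLT_of_ge M 1 (n + 1) (by lia)
  | succ m ih =>
    obtain hmn | hmn := Nat.lt_or_ge m n
    · exact hasProjectiveDimensionLT_of_ge M (m + 2) (n + 1) (by lia)
    refine ih ?_
    let := HasExt.standard (ModuleCat.{u} R)
    rw [HasProjectiveDimensionLE, hasProjectiveDimensionLT_iff]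
    intro i hi Y e
    have hS := shortExact_ker (P := ModuleCat.of R (Y →₀ R)) _
      (Finsupp.linearCombination_id_surjective R Y)
    obtain ⟨x, rfl⟩ := Ext.covariant_sequence_exact₃ M hS e rfl
      (Ext.eq_zero_of_hasProjectiveDimensionLT _ (m + 2) (by lia))
    have := hfree Y
    have hx : x = 0 := Ext.eq_zero_of_hasInjectiveDimensionLT (X := ModuleCat.of R (Y →₀ R)) x
      (n + 1) (by lia)
    rw [hx, Ext.zero_comp]

end HomologicalDimension

/-- If `Λ` is a left noetherian ring, then the left big finitistic
dimension of `Λ` is bounded above by the injective dimension of `Λ` as a left module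
over itself. -/
theorem bigFinDim_le_idim_self (Λ : Type u) [Ring Λ] [IsNoetherianRing Λ] :
    bigFinDim Λ ≤ idim Λ (ModuleCat.of Λ Λ) := by
  refine sSup_le ?_
  rintro _ ⟨hd, M, rfl⟩
  refine le_sInf ?_
  rintro _ ⟨n, rfl, hn⟩
  obtain ⟨m, hm⟩ : ∃ m, PdimLE Λ m M := by
    by_contra! h
    exact hd (sInf_eq_top.2 fun a ⟨k, _, hk⟩ ↦ (h k hk).elim)
  exact sInf_le ⟨n, rfl, PdimLE.of_hasProjectiveDimensionLE <|
    hasProjectiveDimensionLE_of_free (fun ι ↦ hn.hasInjectiveDimensionLE_finsupp ι)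
      hm.hasProjectiveDimensionLE⟩
end

section
/- If Λ is a (two-sided) noetherian ring such that the injective dimension of Λ as a left Λ-module and the injective dimension of Λ as a right Λ-module are both finite, then l Fin dim Λ = r Fin dim Λ = idim(ΛΛ) = idim(ΛΛ) (i.e., the left and right big finitistic dimensions of Λ coincide with the left and right self-injective dimensions, and all four numbers are equal). -/
open CategoryTheory

universe u

namespace FinitisticDimension

open Matrix

section MatrixAction

variable {R : Type u} [Ring R] {X Y Z : Type*} [AddCommGroup X] [Module R X]
  [AddCommGroup Y] [Module R Y] [AddCommGroup Z] [Module R Z] {a b c d : ℕ}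

/-- A matrix over `R` acts on columns with entries in a left `R`-module. -/
def matAct (Y : Type*) [AddCommGroup Y] [Module R Y] (A : Matrix (Fin c) (Fin b) R) :
    (Fin b → Y) →+ (Fin c → Y) where
  toFun y i := ∑ j, A i j • y j
  map_zero' := by ext; simp
  map_add' x y := by ext; simp [Finset.sum_add_distrib]

lemma matAct_apply (A : Matrix (Fin c) (Fin b) R) (y : Fin b → Y) (i : Fin c) :
    matAct Y A y i = ∑ j, A i j • y j := rfl

lemma matAct_mul (A : Matrix (Fin d) (Fin c) R) (B : Matrix (Fin c) (Fin b) R) (y : Fin b → Y) :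
    matAct Y A (matAct Y B y) = matAct Y (A * B) y := by
  ext i
  simp only [matAct_apply, Matrix.mul_apply, Finset.smul_sum, Finset.sum_smul, mul_smul]
  exact Finset.sum_comm

lemma matAct_comp (A : Matrix (Fin c) (Fin b) R) (f : X →ₗ[R] Y) (x : Fin b → X) :
    matAct Y A (f ∘ x) = f ∘ matAct X A x := by
  ext i
  simp [matAct_apply]

/-- Exactness at the middle term of `Y ^ b → Y ^ c → Y ^ d`, the maps being given by `P`, `Q`. -/
def ExactAt (P : Matrix (Fin c) (Fin b) R) (Q : Matrix (Fin d) (Fin c) R)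
    (Y : Type*) [AddCommGroup Y] [Module R Y] : Prop :=
  ∀ y : Fin c → Y, matAct Y Q y = 0 → ∃ z : Fin b → Y, matAct Y P z = y

lemma exists_comp_eq_of_forall {ι X Y : Type*} {f : X → Y} {y : ι → Y} (h : ∀ i, ∃ x, f x = y i) :
    ∃ x : ι → X, f ∘ x = y :=
  ⟨fun i => (h i).choose, funext fun i => (h i).choose_spec⟩

/-- The part `H(Z) → H(X) → H(Y)` of the long exact homology sequence. -/
lemma ExactAt.of_shortExact_left {f : X →ₗ[R] Y} {g : Y →ₗ[R] Z} (hf : Function.Injective f)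
    (hfg : Function.Exact f g) (hg : Function.Surjective g)
    {P : Matrix (Fin b) (Fin a) R} {Q : Matrix (Fin c) (Fin b) R} {T : Matrix (Fin d) (Fin c) R}
    (hQP : Q * P = 0) (hY : ExactAt Q T Y) (hZ : ExactAt P Q Z) : ExactAt Q T X := by
  intro x hx
  obtain ⟨y, hy⟩ := hY (f ∘ x) (by rw [matAct_comp, hx]; ext; simp)
  obtain ⟨z, hz⟩ := hZ (g ∘ y) (by
    rw [matAct_comp, hy]; ext i; exact hfg.apply_apply_eq_zero (x i))
  obtain ⟨y', rfl⟩ := exists_comp_eq_of_forall fun i => hg (z i)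
  obtain ⟨x', hx'⟩ := exists_comp_eq_of_forall (f := f) (y := y - matAct Y P y') fun i => by
    refine (hfg _).1 ?_
    have := congrFun hz i
    rw [matAct_comp] at this
    simp only [Function.comp_apply] at this
    simp [this]
  refine ⟨x', hf.comp_left ?_⟩
  change f ∘ _ = f ∘ _
  rw [← matAct_comp, hx', map_sub, hy, matAct_mul, hQP]
  ext i
  simp [matAct_apply]

/-- The part `H(Y) → H(Z) → H(X)` of the long exact homology sequence. -/
lemma ExactAt.of_shortExact_right {f : X →ₗ[R] Y} {g : Y →ₗ[R] Z} (hf : Function.Injective f)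
    (hfg : Function.Exact f g) (hg : Function.Surjective g)
    {P : Matrix (Fin b) (Fin a) R} {Q : Matrix (Fin c) (Fin b) R} {T : Matrix (Fin d) (Fin c) R}
    (hTQ : T * Q = 0) (hX : ExactAt Q T X) (hY : ExactAt P Q Y) : ExactAt P Q Z := by
  intro z hz
  obtain ⟨y, rfl⟩ := exists_comp_eq_of_forall fun i => hg (z i)
  obtain ⟨x, hx⟩ := exists_comp_eq_of_forall (f := f) (y := matAct Y Q y) fun i => by
    refine (hfg _).1 ?_
    rw [matAct_comp] at hz
    exact congrFun hz i
  obtain ⟨x', rfl⟩ := hX x (hf.comp_left (by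
    change f ∘ _ = f ∘ _
    rw [← matAct_comp, hx, matAct_mul, hTQ]
    ext i
    simp [matAct_apply]))
  obtain ⟨y', hy'⟩ := hY (y - f ∘ x') (by rw [map_sub, matAct_comp, hx, sub_self])
  refine ⟨g ∘ y', ?_⟩
  rw [matAct_comp, hy']
  ext i
  simp [hfg.apply_apply_eq_zero]

lemma sum_smul_apply_single (g : (Fin c → R) →ₗ[R] Y) (v : Fin c → R) :
    ∑ i, v i • g (Pi.single i 1) = g v := by
  simp only [← map_smul, ← map_sum]
  congr 1
  ext k
  simp [Finset.sum_apply, Pi.single_apply]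

lemma exactAt_of_injective {E : Type u} [AddCommGroup E] [Module R E] (hE : Module.Injective R E)
    {P : Matrix (Fin c) (Fin b) R} {Q : Matrix (Fin d) (Fin c) R}
    (h : ∀ v : Fin c → R, v ᵥ* P = 0 → ∃ w, w ᵥ* Q = v) : ExactAt P Q E := by
  intro y hy
  let β := P.vecMulLinear
  let g : (Fin c → R) →ₗ[R] E := Fintype.linearCombination R y
  have hg : LinearMap.ker β ≤ LinearMap.ker g := by
    intro v hv
    obtain ⟨w, rfl⟩ := h v hv
    have : g (w ᵥ* Q) = ∑ i, w i • matAct E Q y i := by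
      simp only [g, Fintype.linearCombination_apply, Matrix.vecMul, dotProduct, matAct_apply,
        Finset.smul_sum, Finset.sum_smul, mul_smul]
      exact Finset.sum_comm
    rw [LinearMap.mem_ker, this, hy]
    simp
  obtain ⟨e, he⟩ := hE.out ((LinearMap.ker β).liftQ β le_rfl)
    (LinearMap.ker_eq_bot.1 (Submodule.ker_liftQ_eq_bot' _ _ rfl))
    ((LinearMap.ker β).liftQ g hg)
  refine ⟨fun j => e (Pi.single j 1), funext fun i => ?_⟩
  have h1 := he (Submodule.Quotient.mk (Pi.single i 1))
  simp only [Submodule.liftQ_apply, β, g, Matrix.vecMulLinear_apply,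
    Matrix.single_one_vecMul, Fintype.linearCombination_apply_single, one_smul] at h1
  rw [← h1, matAct_apply]
  exact sum_smul_apply_single e (P i)

lemma exists_injective_embedding (M : Type u) [AddCommGroup M] [Module R M] :
    ∃ (E : ModuleCat.{u} R) (f : M →ₗ[R] E), Module.Injective R E ∧ Function.Injective f := by
  let E : ModuleCat.{u} R := CategoryTheory.Injective.under (ModuleCat.of R M)
  let f : ModuleCat.of R M ⟶ E := CategoryTheory.Injective.ι (ModuleCat.of R M)
  have hE : CategoryTheory.Injective E :=
    CategoryTheory.Injective.injective_under (ModuleCat.of R M)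
  have hf : Mono f := CategoryTheory.Injective.ι_mono (ModuleCat.of R M)
  exact ⟨E, f.hom, Module.injective_module_of_injective_object R E (inj := hE),
    (ModuleCat.mono_iff_injective f).1 hf⟩

lemma exists_vecMul_eq_of_exactAt {P : Matrix (Fin c) (Fin b) R} {Q : Matrix (Fin d) (Fin c) R}
    (h : ∀ E : ModuleCat.{u} R, Module.Injective R E → ExactAt P Q E)
    (z : Fin c → R) (hz : z ᵥ* P = 0) : ∃ w, w ᵥ* Q = z := by
  let N := LinearMap.range Q.vecMulLinear
  obtain ⟨E, f, hE, hf⟩ := exists_injective_embedding (R := R) ((Fin c → R) ⧸ N)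
  let g := f ∘ₗ N.mkQ
  obtain ⟨w, hw⟩ := h E hE (fun i => g (Pi.single i 1)) (by
    ext i
    change ∑ j, Q i j • g (Pi.single j 1) = 0
    rw [sum_smul_apply_single]
    have : N.mkQ (Q i) = 0 := (Submodule.Quotient.mk_eq_zero _).2 ⟨Pi.single i 1, by
      simp; rfl⟩
    simp [g, this])
  have h0 : g z = 0 := by
    rw [← sum_smul_apply_single]
    have : ∑ i, z i • matAct E P w i = ∑ j, (z ᵥ* P) j • w j := by
      simp only [Matrix.vecMul, dotProduct, matAct_apply,
        Finset.smul_sum, Finset.sum_smul, mul_smul]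
      exact Finset.sum_comm
    rw [hw, hz] at this
    simpa using this
  have h1 : N.mkQ z = 0 := hf (by simpa [g] using h0)
  obtain ⟨w, hw⟩ := (Submodule.Quotient.mk_eq_zero _).1 h1
  exact ⟨w, hw⟩

/-- Projective modules are flat. -/
lemma exactAt_of_projective {F : Type u} [AddCommGroup F] [Module R F] (hF : Module.Projective R F)
    {P : Matrix (Fin c) (Fin b) R} {Q : Matrix (Fin d) (Fin c) R} (h : ExactAt P Q R) :
    ExactAt P Q F := by
  classical
  intro y hy
  obtain ⟨s, hs⟩ := Module.projective_def.1 hF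
  have hker (t : F) : matAct R Q (fun j => s (y j) t) = 0 := by
    ext i
    have := congrArg (fun v => s v t) (congrFun hy i)
    simpa [matAct_apply] using this
  choose w hw using fun t => h _ (hker t)
  let T := Finset.univ.biUnion fun j => (s (y j)).support
  refine ⟨fun j => ∑ t ∈ T, w t j • t, funext fun i => ?_⟩
  have hi : (s (y i)).support ⊆ T := Finset.subset_biUnion_of_mem
    (fun j => (s (y j)).support) (Finset.mem_univ i)
  have h1 : y i = ∑ t ∈ T, s (y i) t • t := by
    conv_lhs => rw [← hs (y i), Finsupp.linearCombination_apply]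
    exact Finsupp.sum_of_support_subset _ hi _ (by simp)
  rw [h1]
  simp only [matAct_apply, Finset.smul_sum]
  rw [Finset.sum_comm]
  refine Finset.sum_congr rfl fun t _ => ?_
  rw [← congrFun (hw t) i, matAct_apply, Finset.sum_smul]
  simp [mul_smul]

end MatrixAction

section Resolution

variable {S : Type u} [Ring S]

/-- The matrices `B i` form an exact complex of free modules of finite rank, acting on rows. -/
def IsResolution {b : ℕ → ℕ} (B : ∀ i, Matrix (Fin (b (i + 1))) (Fin (b i)) S) : Prop :=
  ∀ i v, v ᵥ* B i = 0 ↔ ∃ w, w ᵥ* B (i + 1) = v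

lemma IsResolution.mul_eq_zero {b : ℕ → ℕ} {B : ∀ i, Matrix (Fin (b (i + 1))) (Fin (b i)) S}
    (hB : IsResolution B) (i : ℕ) : B (i + 1) * B i = 0 := by
  ext j k
  have := congrFun ((hB i _).2 ⟨Pi.single j 1, rfl⟩) k
  rw [Matrix.vecMul_vecMul, Matrix.single_one_vecMul] at this
  exact this

lemma exists_rows_span {R M : Type*} [Ring R] [AddCommGroup M] [Module R M] [IsNoetherian R M]
    (N : Submodule R M) :
    ∃ (p : ℕ) (x : Fin p → M), ∀ v, v ∈ N ↔ ∃ w : Fin p → R, ∑ i, w i • x i = v := by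
  obtain ⟨p, x, hx⟩ := Submodule.fg_iff_exists_fin_generating_family.1 (IsNoetherian.noetherian N)
  exact ⟨p, x, fun v => by rw [← hx, Submodule.mem_span_range_iff_exists_fun]⟩

variable [IsNoetherianRing S]

lemma exists_syzygy_matrix {k l : ℕ} (M : Matrix (Fin k) (Fin l) S) :
    ∃ (p : ℕ) (N : Matrix (Fin p) (Fin k) S), ∀ v, v ᵥ* M = 0 ↔ ∃ w, w ᵥ* N = v := by
  obtain ⟨p, x, hx⟩ := exists_rows_span (LinearMap.ker M.vecMulLinear)
  refine ⟨p, Matrix.of x, fun v => (hx v).trans (exists_congr fun w => ?_)⟩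
  rw [Matrix.vecMul_eq_sum]
  rfl

/-- The matrices in a free resolution starting with `M`. -/
noncomputable def syzygySeq {k l : ℕ} (M : Matrix (Fin k) (Fin l) S) :
    ℕ → Σ p q : ℕ, Matrix (Fin p) (Fin q) S
  | 0 => ⟨k, l, M⟩
  | i + 1 => ⟨(exists_syzygy_matrix (syzygySeq M i).2.2).choose, (syzygySeq M i).1,
      (exists_syzygy_matrix (syzygySeq M i).2.2).choose_spec.choose⟩

/-- A free resolution whose first differential is given by `M`. -/
noncomputable def freeResolution {k l : ℕ} (M : Matrix (Fin k) (Fin l) S) (i : ℕ) :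
    Matrix (Fin (syzygySeq M (i + 1)).2.1) (Fin (syzygySeq M i).2.1) S :=
  (syzygySeq M i).2.2

lemma isResolution_freeResolution {k l : ℕ} (M : Matrix (Fin k) (Fin l) S) :
    IsResolution (b := fun i => (syzygySeq M i).2.1) (freeResolution M) := fun i =>
  (exists_syzygy_matrix (syzygySeq M i).2.2).choose_spec.choose_spec

end Resolution

section HomExact

variable {S : Type u} [Ring S]

/-- `Ext ^ (i + 1) (X, N)` vanishes for `n ≤ i` and all `X` resolved by free modules of finite
rank. -/
def HomExact (n : ℕ) (N : Type u) [AddCommGroup N] [Module S N] : Prop :=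
  ∀ (b : ℕ → ℕ) (B : ∀ i, Matrix (Fin (b (i + 1))) (Fin (b i)) S), IsResolution B →
    ∀ i, n ≤ i → ExactAt (B i) (B (i + 1)) N

lemma HomExact.of_idimLE {n : ℕ} {N : ModuleCat.{u} S} (h : IdimLE S n N) :
    HomExact (S := S) n N := by
  induction n generalizing N with
  | zero =>
    intro b B hB i _
    exact exactAt_of_injective h fun v hv => (hB i v).1 hv
  | succ n ih =>
    obtain ⟨E, f, hE, hf, hC⟩ := h
    intro b B hB i hi
    obtain ⟨i, rfl⟩ : ∃ j, i = j + 1 := ⟨i - 1, by omega⟩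
    exact ExactAt.of_shortExact_left hf (LinearMap.exact_map_mkQ_range f)
      (Submodule.mkQ_surjective _) (hB.mul_eq_zero i)
      (exactAt_of_injective hE fun v hv => (hB _ v).1 hv) (ih hC b B hB i (by omega))

lemma injective_of_homExact [IsNoetherianRing S] {N : Type u} [AddCommGroup N] [Module S N]
    (h : HomExact (S := S) 0 N) : Module.Injective S N := by
  refine Module.Baer.injective fun I g => ?_
  obtain ⟨p, x, hx⟩ := exists_rows_span I
  have hxI (i : Fin p) : x i ∈ I := (hx _).2 ⟨Pi.single i 1, by simp [Pi.single_apply]⟩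
  let M : Matrix (Fin p) (Fin 1) S := Matrix.of fun i _ => x i
  have hex : ∃ z : Fin 1 → N, matAct N M z = fun i => g ⟨x i, hxI i⟩ := by
    refine h _ _ (isResolution_freeResolution M) 0 le_rfl _ ?_
    ext j
    let w := freeResolution M 1 j
    change ∑ i, w i • g ⟨x i, hxI i⟩ = 0
    have hw : w ᵥ* M = 0 :=
      (isResolution_freeResolution M 0 _).2 ⟨Pi.single j 1, Matrix.single_one_vecMul _ _⟩
    simp only [← map_smul, ← map_sum]
    rw [← map_zero g]
    congr 1
    ext
    have : ∑ i, w i * x i = 0 := congrFun hw 0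
    simpa using this
  obtain ⟨z, hz⟩ := hex
  refine ⟨LinearMap.toSpanSingleton S N (z 0), fun v hv => ?_⟩
  obtain ⟨w, rfl⟩ := (hx v).1 hv
  have hgi (i : Fin p) : g ⟨x i, hxI i⟩ = x i • z 0 := by
    rw [← congrFun hz i]
    simp [matAct_apply, M]
  have : (⟨∑ i, w i • x i, hv⟩ : I) = ∑ i, w i • ⟨x i, hxI i⟩ := by
    ext
    simp
  rw [this]
  simp only [map_sum, map_smul, hgi, LinearMap.toSpanSingleton_apply, smul_eq_mul, mul_smul]

lemma HomExact.idimLE [IsNoetherianRing S] {n : ℕ} {N : ModuleCat.{u} S}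
    (h : HomExact (S := S) n N) : IdimLE S n N := by
  induction n generalizing N with
  | zero => exact injective_of_homExact h
  | succ n ih =>
    obtain ⟨E, f, hE, hf⟩ := exists_injective_embedding (R := S) N
    refine ⟨E, f, hE, hf, ih fun b B hB i hi => ?_⟩
    exact ExactAt.of_shortExact_right hf (LinearMap.exact_map_mkQ_range f)
      (Submodule.mkQ_surjective _) (hB.mul_eq_zero (i + 1)) (h b B hB (i + 1) (by omega))
      (exactAt_of_injective hE fun v hv => (hB _ v).1 hv)

end HomExact

section TorExact

variable {R S : Type u} [Ring R] [Ring S] (φ : S ≃+* Rᵐᵒᵖ)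

/-- Entrywise transport of a row over `S` along an anti-isomorphism from `S` to `R`. -/
def opRow {k : ℕ} (v : Fin k → S) : Fin k → R := fun i => (φ (v i)).unop

/-- The transpose of a matrix, with entries transported along an anti-isomorphism. -/
def opMat {k l : ℕ} (M : Matrix (Fin k) (Fin l) S) : Matrix (Fin l) (Fin k) R :=
  fun i j => (φ (M j i)).unop

lemma opRow_injective {k : ℕ} : Function.Injective (opRow φ (k := k)) := fun v w h => by
  ext i
  exact φ.injective (MulOpposite.unop_injective (congrFun h i))

lemma opRow_surjective {k : ℕ} : Function.Surjective (opRow φ (k := k)) := fun v =>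
  ⟨fun i => φ.symm (.op (v i)), by ext; simp [opRow]⟩

lemma opRow_zero {k : ℕ} : opRow φ (0 : Fin k → S) = 0 := by
  ext; simp [opRow]

lemma opMat_surjective {k l : ℕ} : Function.Surjective (opMat φ (k := k) (l := l)) := fun A =>
  ⟨fun i j => φ.symm (.op (A j i)), by ext; simp [opMat]⟩

lemma opMat_mul {k l m : ℕ} (M : Matrix (Fin k) (Fin l) S) (N : Matrix (Fin l) (Fin m) S) :
    opMat φ (M * N) = opMat φ N * opMat φ M := by
  ext; simp [opMat, Matrix.mul_apply]

lemma opMat_zero {k l : ℕ} : opMat φ (0 : Matrix (Fin k) (Fin l) S) = 0 := by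
  ext; simp [opMat]

lemma opRow_vecMul {k l : ℕ} (v : Fin k → S) (M : Matrix (Fin k) (Fin l) S) :
    opRow φ (v ᵥ* M) = matAct R (opMat φ M) (opRow φ v) := by
  ext; simp [opMat, opRow, matAct_apply, Matrix.vecMul, dotProduct]

lemma opRow_matAct {k l : ℕ} (z : Fin l → S) (M : Matrix (Fin k) (Fin l) S) :
    opRow φ (matAct S M z) = opRow φ z ᵥ* opMat φ M := by
  ext; simp [opMat, opRow, matAct_apply, Matrix.vecMul, dotProduct]

/-- `Tor (i + 1) (X, Y)` vanishes for `n ≤ i` and all right `R`-modules `X` resolved by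
free modules of finite rank. -/
def TorExact (n : ℕ) (Y : Type u) [AddCommGroup Y] [Module R Y] : Prop :=
  ∀ (b : ℕ → ℕ) (B : ∀ i, Matrix (Fin (b (i + 1))) (Fin (b i)) S), IsResolution B →
    ∀ i, n ≤ i → ExactAt (opMat φ (B (i + 1))) (opMat φ (B i)) Y

variable {φ}

lemma IsResolution.opMat_mul_eq_zero {b : ℕ → ℕ}
    {B : ∀ i, Matrix (Fin (b (i + 1))) (Fin (b i)) S} (hB : IsResolution B) (i : ℕ) :
    opMat φ (B i) * opMat φ (B (i + 1)) = 0 := by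
  rw [← opMat_mul, hB.mul_eq_zero, opMat_zero]

lemma TorExact.of_projective {F : Type u} [AddCommGroup F] [Module R F]
    (hF : Module.Projective R F) : TorExact φ 0 F := by
  refine fun b B hB i _ => exactAt_of_projective hF fun y hy => ?_
  obtain ⟨v, rfl⟩ := opRow_surjective φ y
  rw [← opRow_vecMul, ← opRow_zero φ] at hy
  obtain ⟨w, rfl⟩ := (hB i v).1 (opRow_injective φ hy)
  exact ⟨opRow φ w, (opRow_vecMul φ _ _).symm⟩

lemma TorExact.mono {n m : ℕ} (hnm : n ≤ m) {Y : Type u} [AddCommGroup Y] [Module R Y]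
    (h : TorExact φ n Y) : TorExact φ m Y :=
  fun b B hB i hi => h b B hB i (hnm.trans hi)

lemma TorExact.ker {n : ℕ} {P Y : Type u} [AddCommGroup P] [Module R P] [AddCommGroup Y]
    [Module R Y] (hP : Module.Projective R P) {f : P →ₗ[R] Y} (hf : Function.Surjective f)
    (h : TorExact φ (n + 1) Y) : TorExact φ n (LinearMap.ker f) := fun b B hB i hi =>
  ExactAt.of_shortExact_left (LinearMap.ker f).injective_subtype (LinearMap.exact_subtype_ker_map f)
    hf (hB.opMat_mul_eq_zero (i + 1)) (TorExact.of_projective hP b B hB i (Nat.zero_le _))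
    (h b B hB (i + 1) (by omega))

lemma TorExact.of_ker {n : ℕ} {P Y : Type u} [AddCommGroup P] [Module R P] [AddCommGroup Y]
    [Module R Y] (hP : Module.Projective R P) {f : P →ₗ[R] Y} (hf : Function.Surjective f)
    (h : TorExact φ n (LinearMap.ker f)) : TorExact φ (n + 1) Y := by
  intro b B hB i hi
  obtain ⟨i, rfl⟩ : ∃ j, i = j + 1 := ⟨i - 1, by omega⟩
  exact ExactAt.of_shortExact_right (LinearMap.ker f).injective_subtype
    (LinearMap.exact_subtype_ker_map f) hf (hB.opMat_mul_eq_zero i) (h b B hB i (by omega))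
    (TorExact.of_projective hP b B hB (i + 1) (Nat.zero_le _))

lemma TorExact.of_pdimLE {n : ℕ} {M : ModuleCat.{u} R} (h : PdimLE R n M) : TorExact φ n M := by
  induction n generalizing M with
  | zero => exact TorExact.of_projective h
  | succ n ih =>
    obtain ⟨P, f, hP, hf, hK⟩ := h
    exact TorExact.of_ker hP hf (ih hK)

/-- The flat dimension of an injective left module is at most the right self-injective
dimension. -/
lemma TorExact.of_injective {n : ℕ} (hS : HomExact (S := S) n S) {E : Type u} [AddCommGroup E]
    [Module R E] (hE : Module.Injective R E) : TorExact φ n E := by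
  refine fun b B hB i hi => exactAt_of_injective hE fun v hv => ?_
  obtain ⟨z, rfl⟩ := opRow_surjective φ v
  rw [← opRow_matAct, ← opRow_zero φ] at hv
  obtain ⟨w, rfl⟩ := hS b B hB i hi z (opRow_injective φ hv)
  exact ⟨opRow φ w, (opRow_matAct φ _ _).symm⟩

/-- If injective left modules have flat dimension at most `n`, then so does the right
self-injective dimension. -/
lemma homExact_of_torExact_injective {n : ℕ}
    (h : ∀ E : ModuleCat.{u} R, Module.Injective R E → TorExact φ n E) :
    HomExact (S := S) n S := by
  intro b B hB i hi z hz
  obtain ⟨w, hw⟩ := exists_vecMul_eq_of_exactAt (fun E hE => h E hE b B hB i hi) (opRow φ z) (by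
    rw [← opRow_matAct, hz, opRow_zero])
  obtain ⟨w, rfl⟩ := opRow_surjective φ w
  exact ⟨w, opRow_injective φ (by rw [opRow_matAct, hw])⟩

/-- The equational criterion for flatness. -/
lemma TorExact.exists_factorization [IsNoetherianRing S] {F : Type u} [AddCommGroup F] [Module R F]
    (hF : TorExact φ 0 F) {k l : ℕ} (A : Matrix (Fin k) (Fin l) R) (y : Fin l → F)
    (hy : matAct F A y = 0) :
    ∃ (p : ℕ) (C : Matrix (Fin l) (Fin p) R) (z : Fin p → F), A * C = 0 ∧ matAct F C z = y := by
  obtain ⟨M, rfl⟩ := opMat_surjective φ A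
  have hB := isResolution_freeResolution M
  obtain ⟨z, hz⟩ := hF _ _ hB 0 le_rfl y hy
  exact ⟨_, _, z, hB.opMat_mul_eq_zero 0, hz⟩

/-- Flat modules have injective dimension at most that of the ring. -/
lemma TorExact.homExact [IsNoetherianRing S] {m : ℕ} (hR : HomExact (S := R) m R) {F : Type u}
    [AddCommGroup F] [Module R F] (hF : TorExact φ 0 F) : HomExact (S := R) m F := by
  intro b B hB i hi y hy
  obtain ⟨p, C, z, hC, rfl⟩ := hF.exists_factorization _ y hy
  have hcol (j : Fin p) : ∃ w, matAct R (B i) w = C.col j := hR b B hB i hi _ (by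
    ext k
    exact congrFun (congrFun hC k) j)
  choose w hw using hcol
  have hBC : B i * Matrix.of (fun k j => w j k) = C := by
    ext k j
    exact congrFun (hw j) k
  exact ⟨matAct F (Matrix.of fun k j => w j k) z, by rw [matAct_mul, hBC]⟩

end TorExact

section Dimension

variable {R : Type u} [Ring R]

lemma exists_projective_cover (M : Type u) [AddCommGroup M] [Module R M] :
    ∃ (P : ModuleCat.{u} R) (f : P →ₗ[R] M), Module.Projective R P ∧ Function.Surjective f :=
  ⟨ModuleCat.of R (M →₀ R), Finsupp.linearCombination R id,
    inferInstanceAs (Module.Projective R (M →₀ R)), Finsupp.linearCombination_id_surjective R M⟩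

lemma pdimLE_iff_hasProjectiveDimensionLT {n : ℕ} {M : ModuleCat.{u} R} :
    PdimLE R n M ↔ HasProjectiveDimensionLT M (n + 1) := by
  induction n generalizing M with
  | zero => exact (IsProjective.iff_projective M).trans projective_iff_hasProjectiveDimensionLT_one
  | succ n ih =>
    have key {P : ModuleCat.{u} R} {f : P →ₗ[R] M} (hP : Module.Projective R P)
        (hf : Function.Surjective f) : HasProjectiveDimensionLT M (n + 2) ↔
          PdimLE R n (ModuleCat.of R (LinearMap.ker f)) :=
      ((LinearMap.shortExact_shortComplexKer hf).hasProjectiveDimensionLT_X₃_iff n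
        ((IsProjective.iff_projective P).1 hP)).trans ih.symm
    constructor
    · rintro ⟨P, f, hP, hf, hK⟩
      exact (key hP hf).2 hK
    · intro h
      obtain ⟨P, f, hP, hf⟩ := exists_projective_cover (R := R) M
      exact ⟨P, f, hP, hf, (key hP hf).1 h⟩

lemma pdimLE_mono {n m : ℕ} (hnm : n ≤ m) {M : ModuleCat.{u} R} (h : PdimLE R n M) :
    PdimLE R m M := by
  rw [pdimLE_iff_hasProjectiveDimensionLT] at h ⊢
  exact hasProjectiveDimensionLT_of_ge M (n + 1) (m + 1) (by omega)

lemma hasInjectiveDimensionLT_of_idimLE {n : ℕ} {M : ModuleCat.{u} R} (h : IdimLE R n M) :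
    HasInjectiveDimensionLT M (n + 1) := by
  induction n generalizing M with
  | zero =>
    exact injective_iff_hasInjectiveDimensionLT_one.1
      (Module.injective_object_of_injective_module R M (inj := h))
  | succ n ih =>
    obtain ⟨E, f, hE, hf, hC⟩ := h
    have hE' : Injective E := Module.injective_object_of_injective_module R E
    have hS : (ModuleCat.shortComplexOfCompEqZero f (LinearMap.range f).mkQ
        (LinearMap.range_mkQ_comp f)).ShortExact :=
      ModuleCat.shortComplex_shortExact _ (LinearMap.exact_map_mkQ_range f) hf
        (Submodule.mkQ_surjective _)
    exact hS.hasInjectiveDimensionLT_X₁ (n + 1) (ih hC) inferInstance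

lemma pdim_le {n : ℕ} {M : ModuleCat.{u} R} (h : PdimLE R n M) : pdim R M ≤ n :=
  sInf_le ⟨n, rfl, h⟩

lemma exists_pdimLE_of_pdim_ne_top {M : ModuleCat.{u} R} (h : pdim R M ≠ ⊤) :
    ∃ n : ℕ, pdim R M = n ∧ PdimLE R n M := by
  refine csInf_mem (s := {d : ℕ∞ | ∃ n : ℕ, d = n ∧ PdimLE R n M}) ?_
  by_contra hne
  exact h (by rw [pdim, Set.not_nonempty_iff_eq_empty.1 hne, sInf_empty])

lemma exists_idimLE_of_idim_ne_top {M : ModuleCat.{u} R} (h : idim R M ≠ ⊤) :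
    ∃ n : ℕ, idim R M = n ∧ IdimLE R n M := by
  refine csInf_mem (s := {d : ℕ∞ | ∃ n : ℕ, d = n ∧ IdimLE R n M}) ?_
  by_contra hne
  exact h (by rw [idim, Set.not_nonempty_iff_eq_empty.1 hne, sInf_empty])

lemma idim_le {n : ℕ} {M : ModuleCat.{u} R} (h : IdimLE R n M) : idim R M ≤ n :=
  sInf_le ⟨n, rfl, h⟩

lemma pdim_le_bigFinDim {n : ℕ} {M : ModuleCat.{u} R} (h : PdimLE R n M) :
    pdim R M ≤ bigFinDim R :=
  le_sSup ⟨((pdim_le h).trans_lt (ENat.natCast_lt_top n)).ne, M, rfl⟩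

/-- If projective modules have injective dimension at most `m`, then finite projective
dimensions are at most `m`. -/
lemma pdimLE_of_hasInjectiveDimensionLT {m : ℕ}
    (hR : ∀ P : ModuleCat.{u} R, Module.Projective R P → HasInjectiveDimensionLT P (m + 1))
    {k : ℕ} {M : ModuleCat.{u} R} (h : PdimLE R k M) : PdimLE R m M := by
  rcases le_total k m with hkm | hkm
  · exact pdimLE_mono hkm h
  induction k, hkm using Nat.le_induction with
  | base => exact h
  | succ k hk ih =>
    refine ih ?_
    rw [pdimLE_iff_hasProjectiveDimensionLT] at h ⊢
    refine hasProjectiveDimensionLT_of_enoughInjectives M (k + 1) fun Y => ?_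
    obtain ⟨P, f, hP, hf⟩ := exists_projective_cover (R := R) Y
    have hPi := hR P hP
    refine subsingleton_of_forall_eq 0 fun x => ?_
    obtain ⟨y, rfl⟩ := Abelian.Ext.covariant_sequence_exact₃ M
      (LinearMap.shortExact_shortComplexKer hf) x rfl
      (Abelian.Ext.eq_zero_of_hasProjectiveDimensionLT _ (k + 2) le_rfl)
    rw [Abelian.Ext.eq_zero_of_hasInjectiveDimensionLT y (m + 1) (by omega),
      Abelian.Ext.zero_comp]

lemma bigFinDim_le {m : ℕ}
    (hR : ∀ P : ModuleCat.{u} R, Module.Projective R P → HasInjectiveDimensionLT P (m + 1)) :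
    bigFinDim R ≤ m := by
  refine sSup_le ?_
  rintro _ ⟨hd, M, rfl⟩
  obtain ⟨n, -, hn⟩ := exists_pdimLE_of_pdim_ne_top hd
  exact pdim_le (pdimLE_of_hasInjectiveDimensionLT hR hn)

end Dimension

section Comparison

variable {R S : Type u} [Ring R] [Ring S] {φ : S ≃+* Rᵐᵒᵖ}

/-- A flat module whose `Ext ^ (t + 1)` into flat modules vanishes has projective dimension at
most `t`. -/
lemma TorExact.pdimLE_of_ext {t : ℕ} {F : ModuleCat.{u} R} (hF : TorExact φ 0 F)
    (h : ∀ G : ModuleCat.{u} R, TorExact φ 0 G → ∀ x : Abelian.Ext F G (t + 1), x = 0) :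
    PdimLE R t F := by
  induction t generalizing F with
  | zero =>
    obtain ⟨P, f, hP, hf⟩ := exists_projective_cover (R := R) F
    have hS := LinearMap.shortExact_shortComplexKer hf
    obtain ⟨s, hs⟩ := Abelian.Ext.covariant_sequence_exact₃ F hS (Abelian.Ext.mk₀ (𝟙 F)) rfl
      (h _ (TorExact.ker hP hf (hF.mono zero_le_one)) _)
    obtain ⟨s, rfl⟩ := (Abelian.Ext.mk₀_bijective _ _).2 s
    rw [Abelian.Ext.mk₀_comp_mk₀] at hs
    have hs := (Abelian.Ext.mk₀_bijective _ _).1 hs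
    exact Module.Projective.of_split s.hom f (congrArg ModuleCat.Hom.hom hs)
  | succ t ih =>
    obtain ⟨P, f, hP, hf⟩ := exists_projective_cover (R := R) F
    have hS := LinearMap.shortExact_shortComplexKer hf
    have hP' : Projective P := (IsProjective.iff_projective P).1 hP
    refine ⟨P, f, hP, hf, ih (TorExact.ker hP hf (hF.mono zero_le_one)) fun G hG x => ?_⟩
    obtain ⟨y, rfl⟩ := Abelian.Ext.contravariant_sequence_exact₁ hS G x (add_comm 1 (t + 1))
      (h G hG _)
    rw [Abelian.Ext.eq_zero_of_projective y, Abelian.Ext.comp_zero]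

/-- If flat modules have injective dimension at most `m`, then modules of flat dimension at
most `n` have projective dimension at most `n + m`. -/
lemma TorExact.pdimLE {m : ℕ}
    (hR : ∀ G : ModuleCat.{u} R, TorExact φ 0 G → HasInjectiveDimensionLT G (m + 1))
    {n : ℕ} {M : ModuleCat.{u} R} (h : TorExact φ n M) : PdimLE R (m + n) M := by
  induction n generalizing M with
  | zero =>
    refine h.pdimLE_of_ext fun G hG x => ?_
    have := hR G hG
    exact Abelian.Ext.eq_zero_of_hasInjectiveDimensionLT x (m + 1) le_rfl
  | succ n ih =>
    obtain ⟨P, f, hP, hf⟩ := exists_projective_cover (R := R) M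
    exact ⟨P, f, hP, hf, ih (TorExact.ker hP hf h)⟩

lemma idim_le_bigFinDim_le_idim [IsNoetherianRing R] [IsNoetherianRing S] (φ : S ≃+* Rᵐᵒᵖ)
    (hR : idim R (ModuleCat.of R R) ≠ ⊤) (hS : idim S (ModuleCat.of S S) ≠ ⊤) :
    idim S (ModuleCat.of S S) ≤ bigFinDim R ∧ bigFinDim R ≤ idim R (ModuleCat.of R R) := by
  obtain ⟨m, hm, hRm⟩ := exists_idimLE_of_idim_ne_top hR
  obtain ⟨n, -, hSn⟩ := exists_idimLE_of_idim_ne_top hS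
  have hflat (G : ModuleCat.{u} R) (hG : TorExact φ 0 G) : HasInjectiveDimensionLT G (m + 1) :=
    hasInjectiveDimensionLT_of_idimLE (hG.homExact (HomExact.of_idimLE hRm)).idimLE
  have hle : bigFinDim R ≤ m := bigFinDim_le fun P hP => hflat P (TorExact.of_projective hP)
  refine ⟨?_, hm ▸ hle⟩
  obtain ⟨d, hd⟩ := ENat.ne_top_iff_exists.1 (hle.trans_lt (ENat.natCast_lt_top m)).ne
  rw [← hd]
  refine idim_le (HomExact.idimLE (homExact_of_torExact_injective (φ := φ) fun E hE => ?_))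
  have hE' := (TorExact.of_injective (φ := φ) (HomExact.of_idimLE hSn) hE).pdimLE hflat
  have hEd := pdim_le_bigFinDim hE'
  rw [← hd] at hEd
  obtain ⟨k, hk, hEk⟩ := exists_pdimLE_of_pdim_ne_top (hEd.trans_lt (ENat.natCast_lt_top d)).ne
  rw [hk] at hEd
  exact TorExact.of_pdimLE (pdimLE_mono (by exact_mod_cast hEd) hEk)

end Comparison

end FinitisticDimension

/-- If `Λ` is a (two-sided) noetherian ring whose self-injective
dimensions on both sides are finite, then the left and right big finitistic dimensions
coincide with the left and right self-injective dimensions. -/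
theorem bigFinDim_eq_idim_of_idim_finite (Λ : Type u) [Ring Λ]
    [IsNoetherianRing Λ] [IsNoetherianRing Λᵐᵒᵖ]
    (hl : idim Λ (ModuleCat.of Λ Λ) ≠ ⊤)
    (hr : idim Λᵐᵒᵖ (ModuleCat.of Λᵐᵒᵖ Λᵐᵒᵖ) ≠ ⊤) :
    bigFinDim Λ = bigFinDim Λᵐᵒᵖ ∧
    bigFinDim Λ = idim Λ (ModuleCat.of Λ Λ) ∧
    bigFinDim Λ = idim Λᵐᵒᵖ (ModuleCat.of Λᵐᵒᵖ Λᵐᵒᵖ) := by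
  have h₁ := FinitisticDimension.idim_le_bigFinDim_le_idim (RingEquiv.refl Λᵐᵒᵖ) hl hr
  have h₂ := FinitisticDimension.idim_le_bigFinDim_le_idim (RingEquiv.opOp Λ) hr hl
  exact ⟨le_antisymm (h₁.2.trans h₂.1) (h₂.2.trans h₁.1),
    le_antisymm h₁.2 (h₂.1.trans (h₂.2.trans h₁.1)),
    le_antisymm (h₁.2.trans (h₂.1.trans h₂.2)) h₁.1⟩
end

section
/- For any left module M over an artinian ring Λ, the repetition index of M is bounded above by the syzygy type of M: rep(M) ≤ syzygy type of M. -/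
open CategoryTheory

universe u

section Retracts

variable {R : Type*} [Ring R]

/-- `A` is a retract of `B`: the identity of `A` factors through `B`. -/
def IsModuleRetract (R A B : Type*) [Ring R] [AddCommGroup A] [Module R A]
    [AddCommGroup B] [Module R B] : Prop :=
  ∃ (f : A →ₗ[R] B) (g : B →ₗ[R] A), g ∘ₗ f = LinearMap.id

variable {A B X P : Type*} [AddCommGroup A] [Module R A] [AddCommGroup B] [Module R B]
  [AddCommGroup X] [Module R X] [AddCommGroup P] [Module R P]

lemma IsModuleRetract.of_isUnit (f : A →ₗ[R] B) (g : B →ₗ[R] A)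
    (h : IsUnit (g ∘ₗ f : Module.End R A)) : IsModuleRetract R A B := by
  obtain ⟨u, hu⟩ := h
  refine ⟨f, (↑u⁻¹ : Module.End R A) ∘ₗ g, ?_⟩
  rw [LinearMap.comp_assoc, ← hu]
  exact u.inv_mul

lemma IsModuleRetract.projective (h : IsModuleRetract R A P) [Module.Projective R P] :
    Module.Projective R A :=
  let ⟨f, g, hgf⟩ := h
  Module.Projective.of_split f g hgf

lemma IsModuleRetract.trans_equiv (h : IsModuleRetract R A B) (e : B ≃ₗ[R] X) :
    IsModuleRetract R A X := by
  obtain ⟨f, g, hgf⟩ := h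
  refine ⟨e.toLinearMap ∘ₗ f, g ∘ₗ e.symm.toLinearMap, ?_⟩
  ext x
  simpa using LinearMap.congr_fun hgf x

/-- Suppose the identity of `X` is a finite sum of endomorphisms factoring through modules `Y i`.
A nonprojective module with local endomorphism ring that is a retract of a syzygy of `X` is a
retract of any given syzygy of some `Y i`. -/
lemma IsModuleRetract.exists_ker_of_sum_eq_id [IsLocalRing (Module.End R A)]
    [Module.Projective R P] {p : P →ₗ[R] X} (hp : Function.Surjective p)
    (h : IsModuleRetract R A (LinearMap.ker p)) (hA : ¬ Module.Projective R A)
    {ι : Type*} [Fintype ι] {Y Q : ι → Type*}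
    [∀ i, AddCommGroup (Y i)] [∀ i, Module R (Y i)]
    [∀ i, AddCommGroup (Q i)] [∀ i, Module R (Q i)] [∀ i, Module.Projective R (Q i)]
    (q : ∀ i, Q i →ₗ[R] Y i) (hq : ∀ i, Function.Surjective (q i))
    (a : ∀ i, X →ₗ[R] Y i) (b : ∀ i, Y i →ₗ[R] X) (hab : ∑ i, b i ∘ₗ a i = LinearMap.id) :
    ∃ i, IsModuleRetract R A (LinearMap.ker (q i)) := by
  choose α hα using fun i => Module.projective_lifting_property (q i) (a i ∘ₗ p) (hq i)
  choose β hβ using fun i => Module.projective_lifting_property p (b i ∘ₗ q i) hp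
  have hα' (i : ι) (x : P) : q i (α i x) = a i (p x) := LinearMap.congr_fun (hα i) x
  have hβ' (i : ι) (y : Q i) : p (β i y) = b i (q i y) := LinearMap.congr_fun (hβ i) y
  let α₀ (i : ι) : LinearMap.ker p →ₗ[R] LinearMap.ker (q i) :=
    (α i).restrict fun x hx => by
      rw [LinearMap.mem_ker] at hx ⊢
      rw [hα', hx, map_zero]
  let β₀ (i : ι) : LinearMap.ker (q i) →ₗ[R] LinearMap.ker p :=
    (β i).restrict fun y hy => by
      rw [LinearMap.mem_ker] at hy ⊢
      rw [hβ', hy, map_zero]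
  let γ : P →ₗ[R] LinearMap.ker p :=
    (LinearMap.id - ∑ i, β i ∘ₗ α i).codRestrict _ fun x => by
      have h1 := LinearMap.congr_fun hab (p x)
      simp only [LinearMap.sum_apply, LinearMap.comp_apply, LinearMap.id_apply] at h1
      simp [LinearMap.mem_ker, hα', hβ', h1]
  have hid (x : LinearMap.ker p) : ∑ i, β₀ i (α₀ i x) + γ x = x := by
    apply Subtype.ext
    simp [α₀, β₀, γ]
  obtain ⟨f, g, hgf⟩ := h
  have hsum : ∑ i, ((g ∘ₗ β₀ i) ∘ₗ (α₀ i ∘ₗ f) : Module.End R A) +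
      ((g ∘ₗ γ) ∘ₗ ((LinearMap.ker p).subtype ∘ₗ f) : Module.End R A) = 1 := by
    ext x
    have h1 := congrArg g (hid (f x))
    rw [map_add, map_sum] at h1
    simpa using h1.trans (LinearMap.congr_fun hgf x)
  rcases IsLocalRing.isUnit_or_isUnit_of_add_one hsum with hu | hu
  · obtain ⟨i, -, hi⟩ := IsLocalRing.exists_of_isUnit_sum hu
    exact ⟨i, .of_isUnit _ _ hi⟩
  · exact absurd (IsModuleRetract.of_isUnit _ _ hu).projective hA

end Retracts

lemma IsModuleRetract.isSummand {R : Type u} [Ring R] {A B : ModuleCat.{u} R}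
    (h : IsModuleRetract R A B) : IsSummand R A B := by
  obtain ⟨f, g, hgf⟩ := h
  have hgf' (x : A) : g (f x) = x := LinearMap.congr_fun hgf x
  refine ⟨ModuleCat.of R (LinearMap.ker g), ⟨LinearEquiv.ofLinearMap
    (f.coprod (LinearMap.ker g).subtype)
    (g.prod ((LinearMap.id - f ∘ₗ g).codRestrict (LinearMap.ker g) fun x => by
      simp [LinearMap.mem_ker, hgf'])) ?_ ?_⟩⟩
  · ext x
    simp
  · refine LinearMap.ext fun ⟨x, y, hy⟩ => ?_
    rw [LinearMap.mem_ker] at hy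
    ext <;> simp [hgf', hy]

/-- If `S (n + 1)` is the set of successors of `S n` under a relation on a finite type with at
most `s` elements, then every element of `S s` lies in infinitely many of the sets `S n`. -/
lemma infinite_setOf_mem_of_succ_image {α : Type*} [Fintype α] {s : ℕ}
    (hs : Fintype.card α ≤ s) (E : α → α → Prop) (S : ℕ → Set α)
    (hpred : ∀ n, ∀ j ∈ S (n + 1), ∃ i ∈ S n, E i j)
    (hsucc : ∀ n, ∀ i ∈ S n, ∀ j, E i j → j ∈ S (n + 1)) {j : α} (hj : j ∈ S s) :
    {n | j ∈ S n}.Infinite := by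
  have hpath (n : ℕ) : ∀ j ∈ S n, ∃ p : ℕ → α, p 0 ∈ S 0 ∧ p n = j ∧
      ∀ k < n, E (p k) (p (k + 1)) := by
    induction n with
    | zero => exact fun j hj => ⟨fun _ => j, hj, rfl, by simp⟩
    | succ n ih =>
      intro j hj
      obtain ⟨i, hi, hij⟩ := hpred n j hj
      obtain ⟨p, hp0, hpn, hp⟩ := ih i hi
      refine ⟨fun k => if k ≤ n then p k else j, by simpa, by simp, fun k hk => ?_⟩
      rcases Nat.lt_succ_iff_lt_or_eq.1 hk with hk | rfl
      · simpa [hk.le, Nat.succ_le_of_lt hk] using hp k hk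
      · simpa [hpn] using hij
  obtain ⟨p, hp0, rfl, hp⟩ := hpath s j hj
  have hmove {x m : ℕ} (hx : p x ∈ S m) (d : ℕ) (hd : x + d ≤ s) : p (x + d) ∈ S (m + d) := by
    induction d with
    | zero => exact hx
    | succ d ih => exact hsucc _ _ (ih (by omega)) _ (hp _ (by omega))
  obtain ⟨a, b, hab, hb, hpab⟩ : ∃ a b, a < b ∧ b ≤ s ∧ p a = p b := by
    obtain ⟨x, y, hxy, hpxy⟩ := Fintype.exists_ne_map_eq_of_card_lt
      (fun x : Fin (s + 1) => p x) (by simpa using Nat.lt_succ_of_le hs)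
    rcases lt_or_gt_of_ne hxy with h | h
    · exact ⟨x, y, h, by omega, hpxy⟩
    · exact ⟨y, x, h, by omega, hpxy.symm⟩
  obtain ⟨d, rfl⟩ := Nat.exists_eq_add_of_lt hab
  obtain ⟨e, rfl⟩ := Nat.exists_eq_add_of_le hb
  have hloop (t : ℕ) : p (a + d + 1) ∈ S (a + t * (d + 1)) := by
    induction t with
    | zero => simpa [hpab] using hmove hp0 a (by omega)
    | succ t ih =>
      rw [← hpab] at ih
      have h1 := hmove ih (d + 1) (by omega)
      rwa [add_assoc a, ← Nat.succ_mul] at h1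
  refine Set.infinite_of_forall_exists_gt fun N => ⟨a + (N + 1) * (d + 1) + e, ?_, ?_⟩
  · exact hmove (hloop (N + 1)) e le_rfl
  · nlinarith

/-- A finite product splits as the product over the indices satisfying `p` and the direct sum over
the remaining ones. -/
lemma nonempty_pi_equiv_prod_directSum {R : Type u} [Ring R] {s : ℕ} (A : Fin s → ModuleCat.{u} R)
    (m : Fin s → ℕ) (p : Fin s → Prop) :
    Nonempty (((i : Fin s) → Fin (m i) → A i) ≃ₗ[R]
      ((x : {x : Σ i, Fin (m i) // p x.1}) → A x.1.1) ×
        DirectSum (ULift.{u} {x : Σ i, Fin (m i) // ¬ p x.1}) fun x => A x.down.1.1) := by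
  classical
  let e : ((i : Fin s) → Fin (m i) → A i) ≃ₗ[R]
      ((x : {x : Σ i, Fin (m i) // p x.1}) → A x.1.1) ×
        ((x : ULift.{u} {x : Σ i, Fin (m i) // ¬ p x.1}) → A x.down.1.1) :=
    { toFun := fun f => (fun x => f x.1.1 x.1.2, fun x => f x.down.1.1 x.down.1.2)
      map_add' := fun _ _ => rfl
      map_smul' := fun _ _ => rfl
      invFun := fun g i k => if h : p i then g.1 ⟨⟨i, k⟩, h⟩ else g.2 ⟨⟨⟨i, k⟩, h⟩⟩
      left_inv := fun f => by
        funext i k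
        dsimp only
        split_ifs <;> rfl
      right_inv := fun g => by
        refine Prod.ext (funext fun ⟨x, hx⟩ => ?_) (funext fun ⟨x, hx⟩ => ?_)
        · exact dif_pos hx
        · exact dif_neg hx }
  exact ⟨e.trans ((LinearEquiv.refl R _).prodCongr
    (DirectSum.linearEquivFunOnFintype R _
      fun x : ULift.{u} {x : Σ i, Fin (m i) // ¬ p x.1} => A x.down.1.1).symm)⟩

/-- For any left module `M` over an artinian ring `Λ`, the
repetition index of `M` is bounded above by the syzygy type of `M`. -/
theorem repIndex_le_syzygyType (Λ : Type u) [Ring Λ] [IsArtinianRing Λ]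
    (M : ModuleCat.{u} Λ) (c : SyzygyChain Λ M)
    (s : ℕ) (A : Fin s → ModuleCat.{u} Λ) (h : HasSyzygyType Λ c s A) :
    repIndex Λ c ≤ (s : ℕ∞) := by
  obtain ⟨hlocal, -, -, hdecomp⟩ := h
  let K (i : Fin s) := LinearMap.ker (Finsupp.linearCombination Λ (id : A i → A i))
  have hsurj (i : Fin s) : Function.Surjective (Finsupp.linearCombination Λ (id : A i → A i)) :=
    Finsupp.linearCombination_id_surjective Λ (A i)
  have hfactor (m : Fin s → ℕ) (i : Fin s) (k : Fin (m i)) :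
      IsModuleRetract Λ (A i) ((i : Fin s) → Fin (m i) → A i) := by
    refine ⟨LinearMap.single Λ _ i ∘ₗ LinearMap.single Λ (fun _ => A i) k,
      LinearMap.proj k ∘ₗ LinearMap.proj i, ?_⟩
    ext y
    simp
  let S (n : ℕ) : Set (Fin s) :=
    {i | ¬ Module.Projective Λ (A i) ∧ IsModuleRetract Λ (A i) (c.Ω n)}
  have hinf {j : Fin s} (hj : j ∈ S s) : {n | j ∈ S n}.Infinite := by
    refine infinite_setOf_mem_of_succ_image (by simp)
      (fun i j => ¬ Module.Projective Λ (A j) ∧ IsModuleRetract Λ (A j) (K i)) S ?_ ?_ hj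
    · rintro n j ⟨hjP, hj⟩
      have := hlocal j
      have := c.projective n
      obtain ⟨e₁⟩ := c.isoSucc n
      obtain ⟨m, ⟨e⟩⟩ := hdecomp n
      obtain ⟨⟨i, k⟩, hi⟩ := (hj.trans_equiv e₁).exists_ker_of_sum_eq_id (c.surj n) hjP
        (ι := Σ i, Fin (m i)) (fun x => Finsupp.linearCombination Λ (id : A x.1 → A x.1))
        (fun x => hsurj x.1)
        (fun x => LinearMap.proj x.2 ∘ₗ LinearMap.proj x.1 ∘ₗ e.toLinearMap)
        (fun x => e.symm.toLinearMap ∘ₗ LinearMap.single Λ _ x.1 ∘ₗ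
          LinearMap.single Λ (fun _ => A x.1) x.2) (by
          ext y
          apply e.injective
          have hsum (v : (i : Fin s) → Fin (m i) → A i) :
              ∑ x : Σ i, Fin (m i), Pi.single x.1 (Pi.single x.2 (v x.1 x.2)) = v := by
            rw [Fintype.sum_sigma]
            refine Eq.trans (Finset.sum_congr rfl fun i _ => ?_) (Finset.univ_sum_single v)
            exact (map_sum (LinearMap.single Λ (fun i => Fin (m i) → A i) i) _ _).symm.trans
              (congrArg _ (Finset.univ_sum_single (v i)))
          simpa using hsum (e y))
      refine ⟨i, ⟨fun hiP => ?_, ?_⟩, hjP, hi⟩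
      · obtain ⟨-, f, g, hgf⟩ := hi.exists_ker_of_sum_eq_id (hsurj i) hjP (ι := Unit)
          (fun _ => (LinearMap.id : A i →ₗ[Λ] A i)) (fun _ => Function.surjective_id)
          (fun _ => LinearMap.id) (fun _ => LinearMap.id) (by simp)
        refine zero_ne_one (α := Module.End Λ (A j)) (Eq.trans ?_ hgf)
        ext x
        have hfx : f x = 0 := Subtype.ext (f x).2
        exact (map_zero g).symm.trans (congrArg g hfx.symm)
      · exact (hfactor m i k).trans_equiv e.symm
    · rintro n i ⟨-, f, g, hgf⟩ j ⟨hjP, hj⟩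
      have := hlocal j
      have := c.projective n
      obtain ⟨e₁⟩ := c.isoSucc n
      obtain ⟨-, hj⟩ := hj.exists_ker_of_sum_eq_id (hsurj i) hjP (ι := Unit)
        (fun _ => c.f n) (fun _ => c.surj n) (fun _ => f) (fun _ => g) (by simpa using hgf)
      exact ⟨hjP, hj.trans_equiv e₁.symm⟩
  refine sInf_le ⟨s, rfl, ?_⟩
  obtain ⟨m, ⟨e⟩⟩ := hdecomp s
  obtain ⟨e'⟩ := nonempty_pi_equiv_prod_directSum A m fun i => Module.Projective Λ (A i)
  refine ⟨ULift.{u} {x : Σ i, Fin (m i) // ¬ Module.Projective Λ (A x.1)}, fun x => A x.down.1.1,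
    ModuleCat.of Λ ((x : {x : Σ i, Fin (m i) // Module.Projective Λ (A x.1)}) → A x.1.1),
    ?_, ?_, ⟨e.trans e'⟩⟩
  · have (x : {x : Σ i, Fin (m i) // Module.Projective Λ (A x.1)}) :
        Module.Projective Λ (A x.1.1) := x.2
    classical
    exact .of_equiv (DirectSum.linearEquivFunOnFintype Λ _
      fun x : {x : Σ i, Fin (m i) // Module.Projective Λ (A x.1)} => A x.1.1)
  · rintro ⟨⟨i, k⟩, hi⟩
    exact (hinf (j := i) ⟨hi, (hfactor m i k).trans_equiv e.symm⟩).mono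
      fun n hn => hn.2.isSummand
end

section
/- Let Λ be an artinian ring with Jacobson radical J, and let T be a right Λ-module such that Λ/J, viewed as a right Λ-module, embeds into T. Then the left big finitistic dimension of Λ is bounded above by the repetition index of T: l Fin dim Λ ≤ rep(T). -/
open CategoryTheory

universe u

universe w

/-- A form of Jacobson's criterion that is symmetric in left and right. -/
theorem mem_ringJacobson_iff_isUnit {R : Type*} [Ring R] {x : R} :
    x ∈ Ring.jacobson R ↔ ∀ y, IsUnit (1 + y * x) := by
  rw [← Ideal.jacobson_bot, Ideal.mem_jacobson_iff]
  simp only [Ideal.mem_bot]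
  constructor
  · intro h y
    obtain ⟨z, hz⟩ := h y
    obtain ⟨w, hw⟩ := h (-(z * y))
    have hz' : z * (1 + y * x) = 1 := by
      rw [← sub_eq_zero, ← hz]
      noncomm_ring
    have hw' : w * z = 1 := by
      have : z = 1 - z * y * x := by
        rw [← sub_eq_zero, ← hz]
        noncomm_ring
      rw [this, ← sub_eq_zero, ← hw]
      noncomm_ring
    have : w = 1 + y * x := by
      calc w = w * (z * (1 + y * x)) := by rw [hz', mul_one]
        _ = 1 + y * x := by rw [← mul_assoc, hw', one_mul]
    exact ⟨⟨1 + y * x, z, this ▸ hw', hz'⟩, rfl⟩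
  · intro h y
    obtain ⟨u, hu⟩ := h y
    refine ⟨↑u⁻¹, ?_⟩
    have : (↑u⁻¹ : R) * (1 + y * x) = 1 := by rw [← hu, Units.inv_mul]
    rw [← this]
    noncomm_ring

theorem isUnit_one_add_mul_comm {R : Type*} [Ring R] {x y : R} (h : IsUnit (1 + y * x)) :
    IsUnit (1 + x * y) := by
  obtain ⟨u, hu⟩ := h
  have h1 : (1 + y * x) * (↑u⁻¹ : R) = 1 := by rw [← hu, Units.mul_inv]
  have h2 : (↑u⁻¹ : R) * (1 + y * x) = 1 := by rw [← hu, Units.inv_mul]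
  refine ⟨⟨1 + x * y, 1 - x * ↑u⁻¹ * y, ?_, ?_⟩, rfl⟩
  · calc (1 + x * y) * (1 - x * ↑u⁻¹ * y)
        = 1 + x * y - x * ((1 + y * x) * ↑u⁻¹) * y := by noncomm_ring
      _ = 1 := by rw [h1]; noncomm_ring
  · calc (1 - x * ↑u⁻¹ * y) * (1 + x * y)
        = 1 + x * y - x * (↑u⁻¹ * (1 + y * x)) * y := by noncomm_ring
      _ = 1 := by rw [h2]; noncomm_ring

theorem op_mem_ringJacobson_iff {R : Type*} [Ring R] {x : R} :
    MulOpposite.op x ∈ Ring.jacobson Rᵐᵒᵖ ↔ x ∈ Ring.jacobson R := by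
  simp only [mem_ringJacobson_iff_isUnit]
  have key (y : R) : IsUnit (1 + MulOpposite.op y * MulOpposite.op x) ↔ IsUnit (1 + x * y) := by
    rw [← MulOpposite.op_mul, ← MulOpposite.op_one, ← MulOpposite.op_add, isUnit_op]
  constructor
  · intro h y
    exact isUnit_one_add_mul_comm ((key y).1 (h _))
  · intro h y
    exact (key y.unop).2 (isUnit_one_add_mul_comm (h y.unop))

namespace CharacterModule

variable {R : Type*} [Ring R] {A B : Type*} [AddCommGroup A] [Module R A]
  [AddCommGroup B] [Module R B]

/-- The right module structure on the character module of a left module. -/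
instance mopModule : Module Rᵐᵒᵖ (CharacterModule A) where
  smul r c := AddMonoidHom.comp c (DistribSMul.toAddMonoidHom A r.unop)
  one_smul c := by ext x; exact congrArg c (one_smul R x)
  mul_smul r s c := by ext x; exact congrArg c (mul_smul s.unop r.unop x)
  smul_zero r := rfl
  smul_add r c d := rfl
  add_smul r s c := by
    ext x
    exact (congrArg c (add_smul r.unop s.unop x)).trans (map_add c _ _)
  zero_smul c := by ext x; exact (congrArg c (zero_smul R x)).trans (map_zero c)

/-- Precomposition with a linear map of left modules, as a map of right modules. -/
def mopDual (f : A →ₗ[R] B) : CharacterModule B →ₗ[Rᵐᵒᵖ] CharacterModule A where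
  toFun c := AddMonoidHom.comp c f.toAddMonoidHom
  map_add' _ _ := rfl
  map_smul' r c := by ext x; exact (congrArg c (f.map_smul r.unop x)).symm

theorem mopDual_injective {f : A →ₗ[R] B} (hf : Function.Surjective f) :
    Function.Injective (mopDual f) := by
  intro c d h
  ext b
  obtain ⟨a, rfl⟩ := hf b
  exact DFunLike.congr_fun h a

theorem exists_extension {A B : Type*} [AddCommGroup A] [AddCommGroup B] (f : A →+ B)
    (hf : Function.Injective f) (c : CharacterModule A) :
    ∃ d : CharacterModule B, ∀ a, d (f a) = c a := by
  obtain ⟨d, hd⟩ := dual_surjective_of_injective f.toIntLinearMap hf c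
  exact ⟨d, fun a => DFunLike.congr_fun hd a⟩

theorem mopDual_surjective {f : A →ₗ[R] B} (hf : Function.Injective f) :
    Function.Surjective (mopDual f) := by
  intro c
  obtain ⟨d, hd⟩ := exists_extension f.toAddMonoidHom hf c
  exact ⟨d, by ext a; exact hd a⟩

theorem exact_mopDual {C : Type*} [AddCommGroup C] [Module R C] {f : A →ₗ[R] B} {g : B →ₗ[R] C}
    (hg : Function.Surjective g) (h : Function.Exact f g) :
    Function.Exact (mopDual g) (mopDual f) := by
  intro c
  constructor
  · intro hc
    have hker : (g.toAddMonoidHom).ker ≤ AddMonoidHom.ker (c : B →+ AddCircle (1 : ℚ)) := by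
      intro b hb
      obtain ⟨a, rfl⟩ := (h b).1 hb
      exact DFunLike.congr_fun hc a
    refine ⟨AddMonoidHom.liftOfSurjective g.toAddMonoidHom hg ⟨c, hker⟩, ?_⟩
    ext b
    exact AddMonoidHom.liftOfRightInverse_comp_apply _ _
      (Function.rightInverse_surjInv hg) ⟨_, hker⟩ b
  · rintro ⟨d, rfl⟩
    ext a
    exact (congrArg d (h.apply_apply_eq_zero a)).trans (map_zero d)

/-- The character module of a projective left module is an injective right module. -/
theorem injective_of_projective (R : Type u) [Ring R] (P : Type u) [AddCommGroup P] [Module R P]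
    [Module.Projective R P] : Module.Injective Rᵐᵒᵖ (CharacterModule P) := by
  obtain ⟨s, hs⟩ := Module.projective_def'.1 ‹Module.Projective R P›
  refine ⟨fun X Y _ _ _ _ f hf g => ?_⟩
  choose h hh using fun i : P => exists_extension f.toAddMonoidHom hf
    (AddMonoidHom.comp (AddMonoidHom.eval i) g.toAddMonoidHom : X →+ AddCircle (1 : ℚ))
  let H (y : Y) : P →+ AddCircle (1 : ℚ) :=
    AddMonoidHom.comp (Finsupp.liftAddHom fun i : P =>
      AddMonoidHom.comp (h i : Y →+ AddCircle (1 : ℚ))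
        (AddMonoidHom.comp ((smulAddHom Rᵐᵒᵖ Y).flip y) MulOpposite.opAddEquiv.toAddMonoidHom))
      s.toAddMonoidHom
  have hH (y : Y) (p : P) : H y p = (s p).sum fun i r => h i (MulOpposite.op r • y) := rfl
  refine ⟨{ toFun := fun y => (H y : CharacterModule P), map_add' := ?_, map_smul' := ?_ }, ?_⟩
  · intro y z
    ext p
    change H (y + z) p = H y p + H z p
    simp only [hH, smul_add, map_add]
    exact Finsupp.sum_add
  · intro r y
    ext p
    change H (r • y) p = H y (r.unop • p)
    simp only [hH, map_smul, smul_smul]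
    rw [Finsupp.sum_smul_index fun i => by simp]
    rfl
  · intro x
    ext p
    change H (f x) p = g x p
    have hp : (s p).sum (fun i r => r • i) = p := DFunLike.congr_fun hs p
    rw [hH]
    conv_rhs => rw [← hp, map_finsuppSum]
    refine Finsupp.sum_congr fun i _ => ?_
    rw [← map_smul]
    refine (hh i _).trans ?_
    change g (MulOpposite.op _ • x) i = _
    rw [map_smul]
    rfl

end CharacterModule

section Splitting

variable {R : Type*} [Ring R] {P Q K : Type*} [AddCommGroup P] [Module R P]
  [AddCommGroup Q] [Module R Q] [AddCommGroup K] [Module R K]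

theorem isSemisimpleModule_quotient_jacobson_smul (R : Type*) [Ring R] [IsSemiprimaryRing R]
    (Q : Type*) [AddCommGroup Q] [Module R Q] :
    IsSemisimpleModule R (Q ⧸ (Ring.jacobson R • ⊤ : Submodule R Q)) := by
  have h : Module.IsTorsionBySet R (Q ⧸ (Ring.jacobson R • ⊤ : Submodule R Q))
      (Ring.jacobson R) := by
    intro x r
    obtain ⟨q, rfl⟩ := Submodule.mkQ_surjective _ x
    rw [← map_smul]
    exact (Submodule.Quotient.mk_eq_zero _).2
      (Submodule.smul_mem_smul r.2 Submodule.mem_top)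
  let := h.module
  exact h.isSemisimpleModule_iff.1 inferInstance

theorem isNilpotent_of_range_le_jacobson_smul [IsSemiprimaryRing R] (φ : Module.End R Q)
    (hφ : LinearMap.range φ ≤ Ring.jacobson R • ⊤) : IsNilpotent φ := by
  obtain ⟨n, hn⟩ := IsSemiprimaryRing.isNilpotent (R := R)
  have key (m : ℕ) : LinearMap.range (φ ^ m) ≤ (Ring.jacobson R) ^ m • ⊤ := by
    induction m with
    | zero => rw [Submodule.pow_zero, Ideal.one_eq_top, Submodule.top_smul]; exact le_top
    | succ m ih =>
      rw [pow_succ' φ, Module.End.mul_eq_comp, LinearMap.range_comp, Submodule.pow_succ]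
      calc (LinearMap.range (φ ^ m)).map φ
          ≤ ((Ring.jacobson R) ^ m • (⊤ : Submodule R Q)).map φ := Submodule.map_mono ih
        _ = (Ring.jacobson R) ^ m • LinearMap.range φ := by
            rw [Submodule.map_smul'', Submodule.map_top]
        _ ≤ (Ring.jacobson R) ^ m • (Ring.jacobson R • ⊤) := smul_mono_right _ hφ
        _ = _ := (Submodule.mul_smul _ _ _).symm
  refine ⟨n, LinearMap.range_eq_bot.1 (le_bot_iff.1 ((key n).trans ?_))⟩
  rw [hn]
  simp

/-- Over a semiprimary ring, a map into a projective module which stays injective modulo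
the radical is a split monomorphism. -/
theorem exists_leftInverse_of_injective_mod_jacobson [IsSemiprimaryRing R] [Module.Projective R P]
    (i : Q →ₗ[R] P)
    (hi : ∀ q, i q ∈ (Ring.jacobson R • ⊤ : Submodule R P) →
      q ∈ (Ring.jacobson R • ⊤ : Submodule R Q)) :
    ∃ r : P →ₗ[R] Q, r ∘ₗ i = LinearMap.id := by
  have := isSemisimpleModule_quotient_jacobson_smul R P
  have hle : (Ring.jacobson R • ⊤ : Submodule R Q) ≤
      (Ring.jacobson R • ⊤ : Submodule R P).comap i := by
    rw [← Submodule.map_le_iff_le_comap, Submodule.map_smul'']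
    exact smul_mono_right _ le_top
  let ibar := Submodule.mapQ _ _ i hle
  have hinj : Function.Injective ibar := by
    rw [injective_iff_map_eq_zero]
    intro x hx
    obtain ⟨q, rfl⟩ := Submodule.mkQ_surjective _ x
    exact (Submodule.Quotient.mk_eq_zero _).2 (hi q ((Submodule.Quotient.mk_eq_zero _).1 hx))
  obtain ⟨ρ, hρ⟩ := IsSemisimpleModule.extension_property ibar hinj LinearMap.id
  obtain ⟨r, hr⟩ := Module.projective_lifting_property
    (Submodule.mkQ (Ring.jacobson R • ⊤ : Submodule R Q)) (ρ ∘ₗ Submodule.mkQ _)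
    (Submodule.mkQ_surjective _)
  have hnil : IsNilpotent (1 - r ∘ₗ i : Module.End R Q) := by
    refine isNilpotent_of_range_le_jacobson_smul _ ?_
    rintro _ ⟨q, rfl⟩
    have h1 : Submodule.mkQ (Ring.jacobson R • ⊤ : Submodule R Q) (r (i q)) =
        Submodule.mkQ _ q :=
      (LinearMap.congr_fun hr (i q)).trans (LinearMap.congr_fun hρ (Submodule.mkQ _ q))
    exact (Submodule.Quotient.eq _).1 h1.symm
  obtain ⟨u, hu⟩ := hnil.isUnit_one_sub
  rw [sub_sub_cancel] at hu
  refine ⟨(↑u⁻¹ : Module.End R Q) ∘ₗ r, ?_⟩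
  rw [LinearMap.comp_assoc, ← hu]
  exact u.inv_mul

theorem projective_of_leftInverse_ker_subtype [Module.Projective R P] (f : P →ₗ[R] K)
    (hf : Function.Surjective f) (r : P →ₗ[R] LinearMap.ker f)
    (hr : r ∘ₗ (LinearMap.ker f).subtype = LinearMap.id) : Module.Projective R K := by
  let s : (P ⧸ LinearMap.ker f) →ₗ[R] P :=
    (LinearMap.ker f).liftQ (LinearMap.id - (LinearMap.ker f).subtype ∘ₗ r) (by
      intro p hp
      have := congrArg Subtype.val (LinearMap.congr_fun hr ⟨p, hp⟩)
      exact sub_eq_zero.2 this.symm)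
  let e := f.quotKerEquivOfSurjective hf
  refine Module.Projective.of_split (s ∘ₗ e.symm.toLinearMap) f ?_
  ext x
  obtain ⟨p, rfl⟩ := hf x
  have he : e.symm (f p) = Submodule.Quotient.mk p := by
    rw [LinearEquiv.symm_apply_eq]
    rfl
  have : f (r p : P) = 0 := (r p).2
  change f (s (e.symm (f p))) = f p
  rw [he]
  change f (p - (r p : P)) = f p
  rw [map_sub, this, sub_zero]

/-- If every map from `Rᵐᵒᵖ ⧸ rad` to the character module of `Q` lifts along the dual of
`i : Q → P`, then `i` stays injective modulo the radical. -/
theorem mem_jacobson_smul_of_lift (i : Q →ₗ[R] P)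
    (hlift : ∀ g : (Rᵐᵒᵖ ⧸ ringRadical Rᵐᵒᵖ) →ₗ[Rᵐᵒᵖ] CharacterModule Q,
      ∃ h : (Rᵐᵒᵖ ⧸ ringRadical Rᵐᵒᵖ) →ₗ[Rᵐᵒᵖ] CharacterModule P,
        CharacterModule.mopDual i ∘ₗ h = g)
    (q : Q) (hq : i q ∈ (Ring.jacobson R • ⊤ : Submodule R P)) :
    q ∈ (Ring.jacobson R • ⊤ : Submodule R Q) := by
  by_contra hne
  obtain ⟨c, hc⟩ := CharacterModule.exists_character_apply_ne_zero_of_ne_zero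
    (mt (Submodule.Quotient.mk_eq_zero _).1 hne)
  let χ : CharacterModule Q := AddMonoidHom.comp c
    (Submodule.mkQ (Ring.jacobson R • ⊤ : Submodule R Q)).toAddMonoidHom
  let g : (Rᵐᵒᵖ ⧸ ringRadical Rᵐᵒᵖ) →ₗ[Rᵐᵒᵖ] CharacterModule Q :=
    (ringRadical Rᵐᵒᵖ).liftQ (LinearMap.toSpanSingleton Rᵐᵒᵖ _ χ) (by
      intro r hr
      have hr' : r.unop ∈ Ring.jacobson R := op_mem_ringJacobson_iff.1 hr
      ext x
      have : Submodule.mkQ (Ring.jacobson R • ⊤ : Submodule R Q) (r.unop • x) = 0 :=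
        (Submodule.Quotient.mk_eq_zero _).2 (Submodule.smul_mem_smul hr' Submodule.mem_top)
      exact (congrArg c this).trans (map_zero c))
  obtain ⟨h, hh⟩ := hlift g
  let ψ := h (Submodule.Quotient.mk 1)
  have hψ (a : Q) : ψ (i a) = χ a := by
    have h1 := DFunLike.congr_fun (LinearMap.congr_fun hh (Submodule.Quotient.mk 1)) a
    have h2 : g (Submodule.Quotient.mk 1) = χ := by
      change (1 : Rᵐᵒᵖ) • χ = χ
      exact one_smul _ χ
    rw [h2] at h1
    exact h1
  have hker (p : P) (hp : p ∈ (Ring.jacobson R • ⊤ : Submodule R P)) : ψ p = 0 := by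
    refine Submodule.smul_induction_on hp (fun r hr x _ => ?_) (fun x y hx hy => ?_)
    · change (MulOpposite.op r • ψ) x = 0
      have : MulOpposite.op r • (Submodule.Quotient.mk 1 : Rᵐᵒᵖ ⧸ ringRadical Rᵐᵒᵖ) = 0 := by
        rw [← Submodule.Quotient.mk_smul, Submodule.Quotient.mk_eq_zero, smul_eq_mul, mul_one]
        exact op_mem_ringJacobson_iff.2 hr
      rw [← map_smul, this, map_zero]
      rfl
    · rw [map_add, hx, hy, add_zero]
  exact hc ((hψ q).symm.trans (hker _ hq))

end Splitting

section ExtVanishing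

open Abelian

variable {C : Type*} [Category* C] [Abelian C] [HasExt.{w} C]

theorem subsingleton_ext_left_shift {S : ShortComplex C} (hS : S.ShortExact) [Projective S.X₂]
    (Y : C) (n : ℕ) : Subsingleton (Ext.{w} S.X₃ Y (n + 2)) ↔ Subsingleton (Ext S.X₁ Y (n + 1)) := by
  constructor
  · refine fun h => subsingleton_of_forall_eq 0 fun x => ?_
    obtain ⟨y, rfl⟩ := Ext.contravariant_sequence_exact₁ hS Y x (add_comm 1 (n + 1))
      (Subsingleton.elim _ _)
    rw [y.eq_zero_of_projective, Ext.comp_zero]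
  · refine fun h => subsingleton_of_forall_eq 0 fun x => ?_
    obtain ⟨y, rfl⟩ := Ext.contravariant_sequence_exact₃ hS Y x (Ext.eq_zero_of_projective _)
      (add_comm 1 (n + 1))
    rw [Subsingleton.elim y 0, Ext.comp_zero]

theorem subsingleton_ext_right_shift {S : ShortComplex C} (hS : S.ShortExact) [Injective S.X₂]
    (X : C) (n : ℕ) : Subsingleton (Ext.{w} X S.X₁ (n + 2)) ↔ Subsingleton (Ext X S.X₃ (n + 1)) := by
  constructor
  · refine fun h => subsingleton_of_forall_eq 0 fun x => ?_
    obtain ⟨y, rfl⟩ := Ext.covariant_sequence_exact₃ X hS x rfl (Subsingleton.elim _ _)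
    rw [y.eq_zero_of_injective, Ext.zero_comp]
  · refine fun h => subsingleton_of_forall_eq 0 fun x => ?_
    obtain ⟨y, rfl⟩ := Ext.covariant_sequence_exact₁ X hS x (Ext.eq_zero_of_injective _) rfl
    rw [Subsingleton.elim y 0, Ext.zero_comp]

theorem subsingleton_ext_of_retract {A B : C} (r : Retract A B) (Y : C) (n : ℕ)
    [Subsingleton (Ext.{w} B Y n)] : Subsingleton (Ext.{w} A Y n) := by
  refine subsingleton_of_forall_eq 0 fun x => ?_
  rw [← x.mk₀_id_comp, ← r.retract, ← Ext.mk₀_comp_mk₀_assoc,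
    Subsingleton.elim ((Ext.mk₀ r.r).comp x (zero_add n)) 0, Ext.comp_zero]

/-- Subobjects inherit the vanishing of top-degree `Ext`. -/
theorem subsingleton_ext_of_mono {X T Y : C} (g : X ⟶ T) [Mono g] (n : ℕ)
    [HasInjectiveDimensionLE Y n] [Subsingleton (Ext.{w} T Y n)] :
    Subsingleton (Ext.{w} X Y n) := by
  have hS : (ShortComplex.mk g _ (Limits.cokernel.condition g)).ShortExact :=
    { exact := ShortComplex.exact_cokernel g }
  refine subsingleton_of_forall_eq 0 fun x => ?_
  obtain ⟨y, rfl⟩ := Ext.contravariant_sequence_exact₁ hS Y x (add_comm 1 n)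
    (Ext.eq_zero_of_hasInjectiveDimensionLT _ (n + 1) le_rfl)
  rw [Subsingleton.elim y 0, Ext.comp_zero]

/-- An `Ext` class out of a coproduct vanishes as soon as its components do. -/
theorem ext_eq_zero_of_isColimit_cofan [EnoughInjectives C] {ι : Type*} {A : ι → C}
    {c : Limits.Cofan A} (hc : Limits.IsColimit c) {Y : C} {n : ℕ} (x : Ext.{w} c.pt Y n)
    (hx : ∀ i, (Ext.mk₀ (c.inj i)).comp x (zero_add n) = 0) : x = 0 := by
  induction n generalizing Y with
  | zero =>
    obtain ⟨f, rfl⟩ := Ext.homEquiv₀.symm.surjective x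
    simp only [Ext.homEquiv₀_symm_apply, Ext.mk₀_comp_mk₀, Ext.mk₀_eq_zero_iff] at hx ⊢
    exact Limits.Cofan.IsColimit.hom_ext hc _ _ fun i => by rw [hx, Limits.comp_zero]
  | succ n ih =>
    have hS : (ShortComplex.mk (Injective.ι Y) _ (Limits.cokernel.condition _)).ShortExact :=
      { exact := ShortComplex.exact_cokernel _ }
    obtain ⟨y, rfl⟩ := Ext.covariant_sequence_exact₁ _ hS x (Ext.eq_zero_of_injective _) rfl
    have hz (i : ι) := Ext.covariant_sequence_exact₃ _ hS
      ((Ext.mk₀ (c.inj i)).comp y (zero_add n)) rfl (by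
        rw [Ext.comp_assoc (h₁₂ := zero_add n) (h₂₃ := rfl) (h := by lia)]
        exact hx i)
    choose z hz using hz
    cases n with
    | zero =>
      let w : c.pt ⟶ _ := Limits.Cofan.IsColimit.desc hc fun i => Ext.homEquiv₀ (z i)
      have : y = (Ext.mk₀ w).comp (Ext.mk₀ (Limits.cokernel.π (Injective.ι Y))) (zero_add 0) := by
        rw [← sub_eq_zero]
        refine ih _ fun i => ?_
        rw [sub_eq_add_neg, Ext.comp_add, Ext.comp_neg, ← hz i, Ext.mk₀_comp_mk₀, Ext.mk₀_comp_mk₀,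
          ← Category.assoc, Limits.Cofan.IsColimit.fac, ← Ext.mk₀_comp_mk₀, Ext.mk₀_homEquiv₀_apply, add_neg_cancel]
      rw [this, Ext.comp_assoc (h₁₂ := zero_add 0) (h₂₃ := zero_add 1) (h := by lia),
        hS.comp_extClass, Ext.comp_zero]
    | succ n =>
      rw [ih y fun i => by rw [← hz i, (z i).eq_zero_of_injective, Ext.zero_comp], Ext.zero_comp]

theorem subsingleton_ext_of_isColimit_cofan [EnoughInjectives C] {ι : Type*} {A : ι → C}
    {c : Limits.Cofan A} (hc : Limits.IsColimit c) (Y : C) (n : ℕ)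
    (h : ∀ i, Subsingleton (Ext.{w} (A i) Y n)) : Subsingleton (Ext.{w} c.pt Y n) :=
  subsingleton_of_forall_eq 0 fun x =>
    ext_eq_zero_of_isColimit_cofan hc x fun _ => Subsingleton.elim _ _

end ExtVanishing

section CharacterExt

open Abelian

variable {R : Type u} [Ring R]

/-- The character module of a left module, as an object of the category of right modules. -/
abbrev charObj (M : Type u) [AddCommGroup M] [Module R M] : ModuleCat.{u} Rᵐᵒᵖ :=
  ModuleCat.of Rᵐᵒᵖ (CharacterModule M)

instance injective_charObj (P : Type u) [AddCommGroup P] [Module R P] [Module.Projective R P] :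
    Injective (charObj (R := R) P) :=
  have := CharacterModule.injective_of_projective R P
  Module.injective_object_of_injective_module _ _

/-- The short complex of character modules attached to a presentation `f : P → M`. -/
abbrev charShortComplex {P M : Type u} [AddCommGroup P] [Module R P] [AddCommGroup M]
    [Module R M] (f : P →ₗ[R] M) : ShortComplex (ModuleCat.{u} Rᵐᵒᵖ) where
  X₁ := charObj (R := R) M
  X₂ := charObj (R := R) P
  X₃ := charObj (R := R) (LinearMap.ker f)
  f := ModuleCat.ofHom (CharacterModule.mopDual f)
  g := ModuleCat.ofHom (CharacterModule.mopDual (LinearMap.ker f).subtype)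
  zero := by
    ext c x
    exact (congrArg c x.2).trans (map_zero c)

theorem shortExact_charShortComplex {P M : Type u} [AddCommGroup P] [Module R P] [AddCommGroup M]
    [Module R M] {f : P →ₗ[R] M} (hf : Function.Surjective f) :
    (charShortComplex f).ShortExact :=
  ModuleCat.shortComplex_shortExact _
    (CharacterModule.exact_mopDual hf (LinearMap.exact_subtype_ker_map f))
    (CharacterModule.mopDual_injective hf)
    (CharacterModule.mopDual_surjective (Submodule.injective_subtype _))

theorem PdimLE.hasInjectiveDimensionLE_charObj {n : ℕ} {M : ModuleCat.{u} R}
    (h : PdimLE R n M) : HasInjectiveDimensionLE (charObj (R := R) M) n := by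
  induction n generalizing M with
  | zero =>
    have : Module.Projective R M := h
    infer_instance
  | succ n ih =>
    obtain ⟨P, f, hP, hf, hK⟩ := h
    exact ((shortExact_charShortComplex hf).hasInjectiveDimensionLT_X₃_iff n
      inferInstance).1 (ih hK)

theorem PdimLE.of_subsingleton_ext [IsSemiprimaryRing R] {n : ℕ} {M : ModuleCat.{u} R}
    (h : PdimLE R (n + 1) M)
    (hext : Subsingleton (Ext (radQuot Rᵐᵒᵖ) (charObj (R := R) M) (n + 1))) : PdimLE R n M := by
  induction n generalizing M with
  | zero =>
    obtain ⟨P, f, hP, hf, hK⟩ := h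
    have hlift (g : (Rᵐᵒᵖ ⧸ ringRadical Rᵐᵒᵖ) →ₗ[Rᵐᵒᵖ] CharacterModule (LinearMap.ker f)) :
        ∃ h : (Rᵐᵒᵖ ⧸ ringRadical Rᵐᵒᵖ) →ₗ[Rᵐᵒᵖ] CharacterModule P,
          CharacterModule.mopDual (LinearMap.ker f).subtype ∘ₗ h = g := by
      obtain ⟨y, hy⟩ := Ext.covariant_sequence_exact₃ (radQuot Rᵐᵒᵖ)
        (shortExact_charShortComplex hf) (Ext.mk₀ (ModuleCat.ofHom g)) (zero_add 1)
        (Subsingleton.elim _ _)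
      obtain ⟨y, rfl⟩ := Ext.homEquiv₀.symm.surjective y
      rw [Ext.homEquiv₀_symm_apply, Ext.mk₀_comp_mk₀] at hy
      exact ⟨y.hom, congrArg ModuleCat.Hom.hom (Ext.homEquiv₀.symm.injective hy)⟩
    obtain ⟨r, hr⟩ := exists_leftInverse_of_injective_mod_jacobson (LinearMap.ker f).subtype
      (mem_jacobson_smul_of_lift _ hlift)
    exact projective_of_leftInverse_ker_subtype f hf r hr
  | succ n ih =>
    obtain ⟨P, f, hP, hf, hK⟩ := h
    exact ⟨P, f, hP, hf, ih hK
      ((subsingleton_ext_right_shift (shortExact_charShortComplex hf) _ n).1 hext)⟩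

end CharacterExt

section Syzygies

open Abelian

variable {R : Type u} [Ring R]

theorem IsSummand.subsingleton_ext {A B : ModuleCat.{u} R} (h : IsSummand R A B)
    (Y : ModuleCat.{u} R) (n : ℕ) [Subsingleton (Ext B Y n)] : Subsingleton (Ext A Y n) := by
  obtain ⟨D, ⟨e⟩⟩ := h
  have r : Retract A B :=
    { i := ModuleCat.ofHom (e.toLinearMap ∘ₗ LinearMap.inl R A D)
      r := ModuleCat.ofHom (LinearMap.fst R A D ∘ₗ e.symm.toLinearMap)
      retract := by ext x; simp }
  exact subsingleton_ext_of_retract r Y n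

theorem subsingleton_ext_prod {A B : ModuleCat.{u} R} (Y : ModuleCat.{u} R) (n : ℕ)
    [Subsingleton (Ext A Y n)] [Subsingleton (Ext B Y n)] :
    Subsingleton (Ext (ModuleCat.of R (A × B)) Y n) := by
  have hS := ModuleCat.shortComplex_shortExact
    (ModuleCat.shortComplexOfCompEqZero (LinearMap.inl R A B) (LinearMap.snd R A B) (by ext; rfl))
    Function.Exact.inl_snd LinearMap.inl_injective LinearMap.snd_surjective
  refine subsingleton_of_forall_eq 0 fun x => ?_
  obtain ⟨y, rfl⟩ := Ext.contravariant_sequence_exact₂ hS Y x (Subsingleton.elim _ _)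
  rw [Subsingleton.elim y 0, Ext.comp_zero]

namespace SyzygyChain

variable {M : ModuleCat.{u} R} (c : SyzygyChain R M)

theorem subsingleton_ext_syzygy_succ_iff (j : ℕ) (Y : ModuleCat.{u} R) (n : ℕ) :
    Subsingleton (Ext (c.Ω (j + 1)) Y (n + 1)) ↔ Subsingleton (Ext (c.Ω j) Y (n + 2)) := by
  obtain ⟨e⟩ := c.isoSucc j
  have := c.projective j
  have hS := LinearMap.shortExact_shortComplexKer (c.surj j)
  refine Iff.trans ?_ (subsingleton_ext_left_shift hS Y n).symm
  exact ⟨fun _ => subsingleton_ext_of_retract e.toModuleIso.symm.retract Y _,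
    fun _ => subsingleton_ext_of_retract e.toModuleIso.retract Y _⟩

theorem subsingleton_ext_syzygy_iff (j : ℕ) (Y : ModuleCat.{u} R) (n : ℕ) :
    Subsingleton (Ext (c.Ω j) Y (n + 1)) ↔ Subsingleton (Ext M Y (n + j + 1)) := by
  induction j generalizing n with
  | zero =>
    obtain ⟨e⟩ := c.iso0
    exact ⟨fun _ => subsingleton_ext_of_retract e.toModuleIso.symm.retract Y _,
      fun _ => subsingleton_ext_of_retract e.toModuleIso.retract Y _⟩
  | succ j ih =>
    rw [c.subsingleton_ext_syzygy_succ_iff j Y n, ih (n + 1)]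
    have : n + 1 + j + 1 = n + (j + 1) + 1 := by lia
    rw [this]

end SyzygyChain

/-- If the resolution is repetitive at `k`, then `Ext` into a module of finite injective
dimension vanishes in all degrees above `k`. -/
theorem RepAt.subsingleton_ext {M : ModuleCat.{u} R} {c : SyzygyChain R M} {k : ℕ}
    (h : RepAt R c k) (Y : ModuleCat.{u} R) (d : ℕ) [HasInjectiveDimensionLE Y d]
    (n : ℕ) : Subsingleton (Ext M Y (n + k + 1)) := by
  obtain ⟨ι, A, P, hP, hA, ⟨e⟩⟩ := h
  rw [← c.subsingleton_ext_syzygy_iff k Y n]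
  have hAi (i : ι) : Subsingleton (Ext (A i) Y (n + 1)) := by
    obtain ⟨j, hj, hdj⟩ := (hA i).exists_gt d
    have : Subsingleton (Ext (c.Ω j) Y (n + 1)) :=
      (c.subsingleton_ext_syzygy_iff j Y n).2
        (HasInjectiveDimensionLT.subsingleton Y (d + 1) _ (by lia) M)
    exact hj.subsingleton_ext Y _
  have : Subsingleton (Ext P Y (n + 1)) := Ext.subsingleton_of_projective _ _ _
  have : Subsingleton (Ext (ModuleCat.of R (DirectSum ι fun i => A i)) Y (n + 1)) := by
    classical
    exact subsingleton_ext_of_isColimit_cofan (ModuleCat.coproductCoconeIsColimit A) Y _ hAi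
  have := subsingleton_ext_prod (A := P) (B := ModuleCat.of R (DirectSum ι fun i => A i)) Y (n + 1)
  exact subsingleton_ext_of_retract e.toModuleIso.retract Y _

end Syzygies

theorem exists_pdimLE_of_pdim_ne_top {R : Type u} [Ring R] {M : ModuleCat.{u} R}
    (h : pdim R M ≠ ⊤) : ∃ n : ℕ, pdim R M = n ∧ PdimLE R n M := by
  refine csInf_mem (s := {d : ℕ∞ | ∃ n : ℕ, d = n ∧ PdimLE R n M}) ?_
  by_contra hne
  exact h ((congrArg sInf (Set.not_nonempty_iff_eq_empty.1 hne)).trans sInf_empty)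

/-- Let `Λ` be an artinian ring with Jacobson radical `J` and let
`T` be a right `Λ`-module in which `Λ/J` (as a right `Λ`-module) embeds.  Then the
left big finitistic dimension of `Λ` is bounded above by the repetition index of `T`. -/
theorem bigFinDim_le_repIndex (Λ : Type u) [Ring Λ]
    [IsArtinianRing Λ] [IsArtinianRing Λᵐᵒᵖ]
    (T : ModuleCat.{u} Λᵐᵒᵖ) (cT : SyzygyChain Λᵐᵒᵖ T)
    (hemb : EmbedsIn Λᵐᵒᵖ (radQuot Λᵐᵒᵖ) T) :
    bigFinDim Λ ≤ repIndex Λᵐᵒᵖ cT := by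
  refine sSup_le ?_
  rintro _ ⟨hd, M, rfl⟩
  refine le_sInf ?_
  rintro _ ⟨k, rfl, hk⟩
  obtain ⟨d, hpd, hM⟩ := exists_pdimLE_of_pdim_ne_top hd
  rw [hpd, Nat.cast_le]
  by_contra! hkd
  obtain ⟨n, rfl⟩ := Nat.exists_eq_add_of_lt hkd
  rw [add_comm k n] at hM hpd
  have := hM.hasInjectiveDimensionLE_charObj
  have := hk.subsingleton_ext (charObj (R := Λ) M) (n + k + 1) n
  obtain ⟨g, hg⟩ := hemb
  have : Mono (ModuleCat.ofHom g) := (ModuleCat.mono_iff_injective _).2 hg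
  have hle : PdimLE Λ (n + k) M :=
    hM.of_subsingleton_ext (subsingleton_ext_of_mono (ModuleCat.ofHom g) _)
  have h : pdim Λ M ≤ (n + k : ℕ) := sInf_le ⟨n + k, rfl, hle⟩
  rw [hpd, Nat.cast_le] at h
  lia
end
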